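/- arXiv:math-ph/0504034 — 2 statements merged into one kernel-verified Lean document; each statement's English description precedes it below -/
import Mathlib

section
/- Schwinger–Dyson equation for the mixed two-point function: for every x ∈ ℂ with Im x ≠ 0 and every y ∈ ℂ with Im y ≠ 0, one has (x − V₂′(y) + T·W₂(y)) · W_{1,2}(x,y) + (T/N²)·W_{1,2;2}(x,y;y) = W₂(y) − U(x,y). -/
open MeasureTheory Matrix

noncomputable section

/-- The space `H_N` of `N×N` complex Hermitian matrices. -/
abbrev HermMat (N : ℕ) : Type := selfAdjoint (Matrix (Fin N) (Fin N) ℂ)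

/-- The Boltzmann weight `exp(-(N/T)·Tr(V₁(M₁)+V₂(M₂)-M₁M₂))`. -/
def hweight (N : ℕ) (T : ℝ) (V₁ V₂ : Polynomial ℝ) (M₁ M₂ : Matrix (Fin N) (Fin N) ℂ) : ℂ :=
  Complex.exp (-((N : ℂ) / (T : ℂ)) *
    (Polynomial.aeval M₁ V₁ + Polynomial.aeval M₂ V₂ - M₁ * M₂).trace)

/-- The normalized expectation value `⟨f⟩`. -/
def expectation (N : ℕ) (T : ℝ) (V₁ V₂ : Polynomial ℝ)
    [MeasurableSpace (HermMat N)] (μ : Measure (HermMat N))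
    (f : Matrix (Fin N) (Fin N) ℂ → Matrix (Fin N) (Fin N) ℂ → ℂ) : ℂ :=
  (∫ p : HermMat N × HermMat N, hweight N T V₁ V₂ p.1.1 p.2.1 ∂(μ.prod μ))⁻¹ *
    ∫ p : HermMat N × HermMat N, f p.1.1 p.2.1 * hweight N T V₁ V₂ p.1.1 p.2.1 ∂(μ.prod μ)

/-- The resolvent `W₂(y) = (1/N)⟨Tr (y·1 - M₂)⁻¹⟩`. -/
def resolvent2 (N : ℕ) (T : ℝ) (V₁ V₂ : Polynomial ℝ)
    [MeasurableSpace (HermMat N)] (μ : Measure (HermMat N)) (y : ℂ) : ℂ :=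
  (1 / (N : ℂ)) * expectation N T V₁ V₂ μ fun _ M₂ =>
    ((y • (1 : Matrix (Fin N) (Fin N) ℂ) - M₂)⁻¹).trace

/-- The two-variable polynomial `S_V(u,v) = (V'(u)-V'(v))/(u-v)`, evaluated at a scalar `z`
and a matrix `M`. -/
def SVmat (V : Polynomial ℝ) {N : ℕ} (z : ℂ) (M : Matrix (Fin N) (Fin N) ℂ) :
    Matrix (Fin N) (Fin N) ℂ :=
  ∑ k ∈ Finset.range (V.derivative.natDegree + 1),
    (V.derivative.coeff k : ℂ) • ∑ l ∈ Finset.range k, z ^ l • M ^ (k - 1 - l)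

/-- `U(x,y) = (1/N)⟨Tr((x·1-M₁)⁻¹ S_{V₂}(y,M₂))⟩`. -/
def Ufun (N : ℕ) (T : ℝ) (V₁ V₂ : Polynomial ℝ)
    [MeasurableSpace (HermMat N)] (μ : Measure (HermMat N)) (x y : ℂ) : ℂ :=
  (1 / (N : ℂ)) * expectation N T V₁ V₂ μ fun M₁ M₂ =>
    (((x • (1 : Matrix (Fin N) (Fin N) ℂ) - M₁)⁻¹ * SVmat V₂ y M₂)).trace

/-- The mixed correlator `W_{1,2}(x,y) = (1/N)⟨Tr((x·1-M₁)⁻¹(y·1-M₂)⁻¹)⟩`. -/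
def W12 (N : ℕ) (T : ℝ) (V₁ V₂ : Polynomial ℝ)
    [MeasurableSpace (HermMat N)] (μ : Measure (HermMat N)) (x y : ℂ) : ℂ :=
  (1 / (N : ℂ)) * expectation N T V₁ V₂ μ fun M₁ M₂ =>
    (((x • (1 : Matrix (Fin N) (Fin N) ℂ) - M₁)⁻¹ *
      (y • (1 : Matrix (Fin N) (Fin N) ℂ) - M₂)⁻¹)).trace

/-- The connected correlator `W_{1,2;2}(x,y;y')`. -/
def W122 (N : ℕ) (T : ℝ) (V₁ V₂ : Polynomial ℝ)
    [MeasurableSpace (HermMat N)] (μ : Measure (HermMat N)) (x y y' : ℂ) : ℂ :=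
  expectation N T V₁ V₂ μ (fun M₁ M₂ =>
      (((x • (1 : Matrix (Fin N) (Fin N) ℂ) - M₁)⁻¹ *
        (y • (1 : Matrix (Fin N) (Fin N) ℂ) - M₂)⁻¹)).trace *
        ((y' • (1 : Matrix (Fin N) (Fin N) ℂ) - M₂)⁻¹).trace)
    - (N : ℂ) ^ 2 * W12 N T V₁ V₂ μ x y * resolvent2 N T V₁ V₂ μ y'

end


section SDHelpers

instance sd_herm_sc (N : ℕ) : SecondCountableTopology (HermMat N) := by
  have : SecondCountableTopology (Fin N → Fin N → ℂ) := inferInstance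
  have : SecondCountableTopology (Matrix (Fin N) (Fin N) ℂ) := this
  exact TopologicalSpace.Subtype.secondCountableTopology _

lemma sd_pow_exp_bound (a : ℝ) (ha : 0 < a) (k m : ℕ) : ∃ K : ℝ, 0 ≤ K ∧ ∀ s : ℝ, 0 ≤ s →
    (1 + s) ^ k * Real.exp (-a * s) ≤ K * ((1 + s) ^ m)⁻¹ := by
  refine ⟨Real.exp a * ((k + m).factorial / a ^ (k + m)), by positivity, fun s hs => ?_⟩
  have h := Real.pow_div_factorial_le_exp (x := a * (1 + s)) (by positivity) (k + m)
  have e : Real.exp (-a * s) = Real.exp a * (Real.exp (a * (1 + s)))⁻¹ := by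
    rw [← Real.exp_neg, ← Real.exp_add]; congr 1; ring
  rw [e]
  have h2 : (Real.exp (a * (1 + s)))⁻¹ ≤ ((a * (1 + s)) ^ (k + m) / (k + m).factorial)⁻¹ :=
    inv_anti₀ (by positivity) h
  calc (1 + s) ^ k * (Real.exp a * (Real.exp (a * (1 + s)))⁻¹)
      ≤ (1 + s) ^ k * (Real.exp a * ((a * (1 + s)) ^ (k + m) / (k + m).factorial)⁻¹) := by
        gcongr
    _ = _ := by
        rw [mul_pow, pow_add (1 + s)]
        field_simp

lemma sd_integral_lineDeriv_zero {E : Type*} [NormedAddCommGroup E] [NormedSpace ℝ E]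
    [FiniteDimensional ℝ E] [MeasurableSpace E] [BorelSpace E] (ν : Measure E)
    [ν.IsAddHaarMeasure] (F F' : E → ℂ) (v : E) (hF : Integrable F ν) (hF' : Integrable F' ν)
    (hd : ∀ p, HasDerivAt (fun t : ℝ => F (p + t • v)) (F' p) 0) : ∫ p, F' p ∂ν = 0 := by
  have h := integral_bilinear_hasLineDerivAt_right_eq_neg_left_of_integrable (μ := ν)
    (f := fun _ => (1 : ℂ)) (f' := fun _ => 0) (g := F) (g' := F') (v := v)
    (B := ContinuousLinearMap.mul ℝ ℂ) (by simp) (by simpa using hF') (by simpa using hF)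
    (fun x _ => by simpa [HasLineDerivAt] using hasDerivAt_const (0 : ℝ) (1 : ℂ))
    (fun x _ => hd x)
  simpa using h

lemma sd_integrable_of_bound {E : Type*} [NormedAddCommGroup E] [NormedSpace ℝ E]
    [FiniteDimensional ℝ E] [MeasurableSpace E] [BorelSpace E] (ν : Measure E)
    [ν.IsAddHaarMeasure] (F : E → ℂ) (hF : Continuous F) (s : E → ℝ)
    (hs : ∀ p, ‖p‖ ^ 2 ≤ s p) (a : ℝ) (ha : 0 < a) (K : ℝ) (hK : 0 ≤ K) (k : ℕ)
    (hb : ∀ p, ‖F p‖ ≤ K * ((1 + s p) ^ k * Real.exp (-a * s p))) : Integrable F ν := by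
  set m : ℕ := Module.finrank ℝ E + 1
  obtain ⟨K', hK', hb'⟩ := sd_pow_exp_bound a ha k m
  have hi : Integrable (fun x : E ↦ (1 + ‖x‖) ^ (-(m : ℝ))) ν :=
    integrable_one_add_norm (by simp [m])
  refine (hi.const_mul (K * (K' * 2 ^ m))).mono' hF.aestronglyMeasurable
    (Filter.Eventually.of_forall fun p => ?_)
  have hsp : 0 ≤ s p := (sq_nonneg _).trans (hs p)
  refine (hb p).trans ?_
  rw [mul_assoc K]
  refine mul_le_mul_of_nonneg_left ?_ hK
  refine (hb' _ hsp).trans ?_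
  rw [mul_assoc K']
  refine mul_le_mul_of_nonneg_left ?_ hK'
  rw [Real.rpow_neg (by positivity), Real.rpow_natCast]
  have h1 : 1 + ‖p‖ ≤ 2 * (1 + s p) := by nlinarith [hs p, sq_nonneg (‖p‖ - 1)]
  have h2 : (1 + ‖p‖) ^ m ≤ 2 ^ m * (1 + s p) ^ m := by
    rw [← mul_pow]; gcongr
  have hp : 0 < (1 + ‖p‖) ^ m := by positivity
  have hq : 0 < (1 + s p) ^ m := by positivity
  rw [inv_le_iff_one_le_mul₀ hq]
  rw [mul_assoc, ← div_eq_inv_mul, mul_div_assoc', le_div_iff₀ hp]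
  linarith

/-- Squared Hilbert-Schmidt size. -/
noncomputable def sdSize {N : ℕ} (M : Matrix (Fin N) (Fin N) ℂ) : ℝ := ∑ i, ∑ j, ‖M i j‖ ^ 2

lemma sdSize_nonneg {N : ℕ} (M : Matrix (Fin N) (Fin N) ℂ) : 0 ≤ sdSize M := by
  unfold sdSize; positivity

lemma sd_entry_le {N : ℕ} (M : Matrix (Fin N) (Fin N) ℂ) (i j : Fin N) :
    ‖M i j‖ ^ 2 ≤ sdSize M := by
  unfold sdSize
  refine le_trans ?_ (Finset.single_le_sum (f := fun i => ∑ j, ‖M i j‖ ^ 2)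
    (fun i _ => by positivity) (Finset.mem_univ i))
  exact Finset.single_le_sum (f := fun j => ‖M i j‖ ^ 2)
    (fun i _ => by positivity) (Finset.mem_univ j)

/-- Size of a pair. -/
noncomputable def sdSize2 {N : ℕ} (p : HermMat N × HermMat N) : ℝ := sdSize p.1.1 + sdSize p.2.1

lemma sdSize2_nonneg {N : ℕ} (p : HermMat N × HermMat N) : 0 ≤ sdSize2 p :=
  add_nonneg (sdSize_nonneg _) (sdSize_nonneg _)

section Norm0
attribute [local instance] Matrix.normedAddCommGroup Matrix.normedSpace

/-- Inclusion as a linear map. -/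
noncomputable def sdIncl (N : ℕ) : HermMat N →ₗ[ℝ] Matrix (Fin N) (Fin N) ℂ where
  toFun := fun M => M.1
  map_add' := fun _ _ => rfl
  map_smul' := fun _ _ => rfl

instance sd_herm_finiteDimensional (N : ℕ) : FiniteDimensional ℝ (HermMat N) := by
  have : FiniteDimensional ℝ (Matrix (Fin N) (Fin N) ℂ) := Module.Finite.trans ℂ _
  exact Module.Finite.of_injective (sdIncl N) Subtype.val_injective

lemma sd_proper (N : ℕ) : ProperSpace (HermMat N) := FiniteDimensional.proper ℝ _
lemma sd_lc' (N : ℕ) : LocallyCompactSpace (HermMat N) :=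
  @locallyCompact_of_proper _ _ (sd_proper N)
end Norm0

instance sd_lc (N : ℕ) : LocallyCompactSpace (HermMat N) := sd_lc' N

lemma sd_borel (N : ℕ) [MeasurableSpace (HermMat N)] [BorelSpace (HermMat N)] :
    BorelSpace (HermMat N × HermMat N) := inferInstance

lemma sd_haar (N : ℕ) [MeasurableSpace (HermMat N)] [BorelSpace (HermMat N)]
    (μ : Measure (HermMat N)) [μ.IsAddHaarMeasure] : (μ.prod μ).IsAddHaarMeasure := inferInstance

section Norm
attribute [local instance] Matrix.normedAddCommGroup Matrix.normedSpace

lemma sd_norm_le {N : ℕ} (p : HermMat N × HermMat N) : ‖p‖ ^ 2 ≤ sdSize2 p := by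
  have h : ‖p‖ ≤ Real.sqrt (sdSize2 p) := by
    refine max_le ?_ ?_
    · refine (Matrix.norm_le_iff (A := p.1.1) (Real.sqrt_nonneg _)).2 fun i j => ?_
      refine Real.le_sqrt_of_sq_le ?_
      exact (sd_entry_le _ i j).trans (le_add_of_nonneg_right (sdSize_nonneg _))
    · refine (Matrix.norm_le_iff (A := p.2.1) (Real.sqrt_nonneg _)).2 fun i j => ?_
      refine Real.le_sqrt_of_sq_le ?_
      exact (sd_entry_le _ i j).trans (le_add_of_nonneg_left (sdSize_nonneg _))
  calc ‖p‖ ^ 2 ≤ Real.sqrt (sdSize2 p) ^ 2 := by gcongr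
    _ = _ := Real.sq_sqrt (sdSize2_nonneg p)

lemma sd_integrable_herm {N : ℕ} [MeasurableSpace (HermMat N)] [BorelSpace (HermMat N)]
    (μ : Measure (HermMat N)) [μ.IsAddHaarMeasure] (F : HermMat N × HermMat N → ℂ)
    (hF : Continuous F) (a : ℝ) (ha : 0 < a) (K : ℝ) (hK : 0 ≤ K) (k : ℕ)
    (hb : ∀ p, ‖F p‖ ≤ K * ((1 + sdSize2 p) ^ k * Real.exp (-a * sdSize2 p))) :
    Integrable F (μ.prod μ) := by
  exact @sd_integrable_of_bound _ _ _ _ _ (sd_borel N) (μ.prod μ) (sd_haar N μ) F hF sdSize2 sd_norm_le a ha K hK k hb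

lemma sd_ibp_herm {N : ℕ} [MeasurableSpace (HermMat N)] [BorelSpace (HermMat N)]
    (μ : Measure (HermMat N)) [μ.IsAddHaarMeasure] (F F' : HermMat N × HermMat N → ℂ)
    (v : HermMat N × HermMat N)
    (hF : Integrable F (μ.prod μ)) (hF' : Integrable F' (μ.prod μ))
    (hd : ∀ p, HasDerivAt (fun t : ℝ => F (p + t • v)) (F' p) 0) :
    ∫ p, F' p ∂(μ.prod μ) = 0 := by
  exact @sd_integral_lineDeriv_zero _ _ _ _ _ (sd_borel N) (μ.prod μ) (sd_haar N μ) F F' v hF hF' hd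

end Norm


/-- Continuous functions of polynomial growth. -/
def SDGood {N : ℕ} (f : HermMat N × HermMat N → ℂ) : Prop :=
  Continuous f ∧ ∃ K : ℝ, ∃ k : ℕ, 0 ≤ K ∧ ∀ p, ‖f p‖ ≤ K * (1 + sdSize2 p) ^ k

lemma SDGood.of_bounded {N : ℕ} {f : HermMat N × HermMat N → ℂ} (hf : Continuous f) (K : ℝ)
    (h : ∀ p, ‖f p‖ ≤ K) : SDGood f :=
  ⟨hf, K, 0, (norm_nonneg _).trans (h 0), by simpa using h⟩

lemma SDGood.const {N : ℕ} (c : ℂ) : SDGood (fun _ : HermMat N × HermMat N => c) :=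
  SDGood.of_bounded continuous_const ‖c‖ fun _ => le_rfl

lemma SDGood.add {N : ℕ} {f g : HermMat N × HermMat N → ℂ} (hf : SDGood f) (hg : SDGood g) :
    SDGood (fun p => f p + g p) := by
  obtain ⟨hf, K, k, hK, hb⟩ := hf
  obtain ⟨hg, L, l, hL, hb'⟩ := hg
  refine ⟨hf.add hg, K + L, k + l, by positivity, fun p => (norm_add_le _ _).trans ?_⟩
  have h1 : 1 ≤ 1 + sdSize2 p := by linarith [sdSize2_nonneg p]
  rw [add_mul]
  refine add_le_add ((hb p).trans ?_) ((hb' p).trans ?_)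
  · gcongr
    · omega
  · gcongr
    · omega

lemma SDGood.mul {N : ℕ} {f g : HermMat N × HermMat N → ℂ} (hf : SDGood f) (hg : SDGood g) :
    SDGood (fun p => f p * g p) := by
  obtain ⟨hf, K, k, hK, hb⟩ := hf
  obtain ⟨hg, L, l, hL, hb'⟩ := hg
  refine ⟨hf.mul hg, K * L, k + l, by positivity, fun p => ?_⟩
  have h1 : 0 ≤ 1 + sdSize2 p := by linarith [sdSize2_nonneg p]
  rw [norm_mul, pow_add, mul_mul_mul_comm]
  exact mul_le_mul (hb p) (hb' p) (norm_nonneg _) (by positivity)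

lemma SDGood.sum {N : ℕ} {ι : Type*} (s : Finset ι) {f : ι → HermMat N × HermMat N → ℂ}
    (hf : ∀ i ∈ s, SDGood (f i)) : SDGood (fun p => ∑ i ∈ s, f i p) := by
  classical
  induction s using Finset.induction_on with
  | empty => simpa using SDGood.const 0
  | insert a s ha ih =>
    simp only [Finset.sum_insert ha]
    exact (hf a (by simp)).add (ih fun i hi => hf i (by simp [hi]))

/-- Matrix valued version. -/
def SDGoodM {N : ℕ} (F : HermMat N × HermMat N → Matrix (Fin N) (Fin N) ℂ) : Prop :=
  ∀ i j, SDGood (fun p => F p i j)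

lemma SDGoodM.const {N : ℕ} (A : Matrix (Fin N) (Fin N) ℂ) :
    SDGoodM (fun _ : HermMat N × HermMat N => A) := fun _ _ => SDGood.const _

lemma SDGoodM.add {N : ℕ} {F G : HermMat N × HermMat N → Matrix (Fin N) (Fin N) ℂ}
    (hF : SDGoodM F) (hG : SDGoodM G) : SDGoodM (fun p => F p + G p) :=
  fun i j => (hF i j).add (hG i j)

lemma SDGoodM.mul {N : ℕ} {F G : HermMat N × HermMat N → Matrix (Fin N) (Fin N) ℂ}
    (hF : SDGoodM F) (hG : SDGoodM G) : SDGoodM (fun p => F p * G p) := fun i j => by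
  simp only [Matrix.mul_apply]
  exact SDGood.sum _ fun k _ => (hF i k).mul (hG k j)

lemma SDGoodM.smul {N : ℕ} {F : HermMat N × HermMat N → Matrix (Fin N) (Fin N) ℂ}
    (hF : SDGoodM F) (c : ℂ) : SDGoodM (fun p => c • F p) :=
  fun i j => (SDGood.const c).mul (hF i j)

lemma SDGoodM.sub {N : ℕ} {F G : HermMat N × HermMat N → Matrix (Fin N) (Fin N) ℂ}
    (hF : SDGoodM F) (hG : SDGoodM G) : SDGoodM (fun p => F p - G p) := by
  have h := hF.add (hG.smul (-1))
  simpa [sub_eq_add_neg] using h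

lemma SDGoodM.pow {N : ℕ} {F : HermMat N × HermMat N → Matrix (Fin N) (Fin N) ℂ}
    (hF : SDGoodM F) (k : ℕ) : SDGoodM (fun p => F p ^ k) := by
  induction k with
  | zero => simpa using SDGoodM.const 1
  | succ k ih => simpa only [pow_succ] using ih.mul hF

lemma SDGoodM.sum {N : ℕ} {ι : Type*} (s : Finset ι)
    {F : ι → HermMat N × HermMat N → Matrix (Fin N) (Fin N) ℂ}
    (hF : ∀ i ∈ s, SDGoodM (F i)) : SDGoodM (fun p => ∑ i ∈ s, F i p) := fun i j => by
  simp only [Matrix.sum_apply]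
  exact SDGood.sum s fun k hk => hF k hk i j

lemma SDGoodM.trace {N : ℕ} {F : HermMat N × HermMat N → Matrix (Fin N) (Fin N) ℂ}
    (hF : SDGoodM F) : SDGood (fun p => (F p).trace) :=
  SDGood.sum _ fun i _ => hF i i

lemma sd_aeval_eq {N : ℕ} (V : Polynomial ℝ) (M : Matrix (Fin N) (Fin N) ℂ) :
    Polynomial.aeval M V = ∑ i ∈ Finset.range (V.natDegree + 1), (V.coeff i : ℂ) • M ^ i := by
  rw [Polynomial.aeval_eq_sum_range]
  rfl

lemma SDGoodM.aeval {N : ℕ} {F : HermMat N × HermMat N → Matrix (Fin N) (Fin N) ℂ}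
    (hF : SDGoodM F) (V : Polynomial ℝ) : SDGoodM (fun p => Polynomial.aeval (F p) V) := by
  simp only [sd_aeval_eq]
  exact SDGoodM.sum _ fun i _ => (hF.pow i).smul _

lemma SDGoodM.SV {N : ℕ} {F : HermMat N × HermMat N → Matrix (Fin N) (Fin N) ℂ}
    (hF : SDGoodM F) (V : Polynomial ℝ) (z : ℂ) : SDGoodM (fun p => SVmat V z (F p)) :=
  SDGoodM.sum _ fun _ _ => (SDGoodM.sum _ fun _ _ => (hF.pow _).smul _).smul _

lemma sd_continuous_fst (N : ℕ) : Continuous fun p : HermMat N × HermMat N => p.1.1 :=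
  continuous_subtype_val.comp continuous_fst
lemma sd_continuous_snd (N : ℕ) : Continuous fun p : HermMat N × HermMat N => p.2.1 :=
  continuous_subtype_val.comp continuous_snd

lemma SDGoodM.fst (N : ℕ) : SDGoodM (fun p : HermMat N × HermMat N => p.1.1) := fun i j => by
  refine ⟨(sd_continuous_fst N).matrix_elem i j, 1, 1, zero_le_one, fun p => ?_⟩
  have h1 := sd_entry_le p.1.1 i j
  have h2 := sdSize_nonneg p.2.1
  unfold sdSize2
  nlinarith [sq_nonneg (‖p.1.1 i j‖ - 1)]

lemma SDGoodM.snd (N : ℕ) : SDGoodM (fun p : HermMat N × HermMat N => p.2.1) := fun i j => by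
  refine ⟨(sd_continuous_snd N).matrix_elem i j, 1, 1, zero_le_one, fun p => ?_⟩
  have h1 := sd_entry_le p.2.1 i j
  have h2 := sdSize_nonneg p.1.1
  unfold sdSize2
  nlinarith [sq_nonneg (‖p.2.1 i j‖ - 1)]

lemma sd_det_ne {N : ℕ} (M : HermMat N) (y : ℂ) (hy : y.im ≠ 0) :
    (y • (1 : Matrix (Fin N) (Fin N) ℂ) - M.1).det ≠ 0 := by
  intro h
  obtain ⟨v, hv, hv0⟩ := Matrix.exists_mulVec_eq_zero_iff.2 h
  have hM : M.1.IsHermitian := M.2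
  have h1 := hM.im_star_dotProduct_mulVec_self v
  have h2 : M.1 *ᵥ v = y • v := by
    rw [Matrix.sub_mulVec, Matrix.smul_mulVec, Matrix.one_mulVec, sub_eq_zero] at hv0
    exact hv0.symm
  rw [h2, dotProduct_smul] at h1
  have h3 : star v ⬝ᵥ v = ((∑ i, ‖v i‖ ^ 2 : ℝ) : ℂ) := by
    simp only [dotProduct, Pi.star_apply, Complex.ofReal_sum]
    refine Finset.sum_congr rfl fun i _ => ?_
    have := Complex.conj_mul' (v i)
    simpa using this
  rw [h3] at h1
  have h4 : y.im * (∑ i, ‖v i‖ ^ 2) = 0 := by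
    generalize (∑ i, ‖v i‖ ^ 2) = S at h1 ⊢
    rw [smul_eq_mul] at h1
    change (y * (S : ℂ)).im = 0 at h1
    rwa [Complex.im_mul_ofReal] at h1
  have h5 : ∑ i, ‖v i‖ ^ 2 = 0 := (mul_eq_zero.1 h4).resolve_left hy
  apply hv
  funext i
  have := (Finset.sum_eq_zero_iff_of_nonneg (fun i _ => by positivity)).1 h5 i (Finset.mem_univ i)
  simpa using this

lemma sd_inv_bound {N : ℕ} (M : HermMat N) (y : ℂ) (hy : y.im ≠ 0) (i j : Fin N) :
    ‖(y • (1 : Matrix (Fin N) (Fin N) ℂ) - M.1)⁻¹ i j‖ ≤ |y.im|⁻¹ := by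
  set R := y • (1 : Matrix (Fin N) (Fin N) ℂ) - M.1 with hR
  have hu : IsUnit R.det := (sd_det_ne M y hy).isUnit
  set B := R⁻¹ with hB
  have hRB : R * B = 1 := Matrix.mul_nonsing_inv _ hu
  have hBR : Bᴴ * Rᴴ = 1 := by rw [← Matrix.conjTranspose_mul, hRB, Matrix.conjTranspose_one]
  have hM : M.1ᴴ = M.1 := M.2
  have hRR : R - Rᴴ = (y - star y) • (1 : Matrix (Fin N) (Fin N) ℂ) := by
    rw [hR, Matrix.conjTranspose_sub, Matrix.conjTranspose_smul, Matrix.conjTranspose_one, hM,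
      sub_smul]
    abel
  have key : Bᴴ - B = (y - star y) • (Bᴴ * B) := by
    calc Bᴴ - B = Bᴴ * (R - Rᴴ) * B := by
          rw [mul_sub, sub_mul, mul_assoc, hRB, hBR, mul_one, one_mul]
      _ = _ := by rw [hRR]; simp
  have hjj := congrFun (congrFun key j) j
  have hsum : (Bᴴ * B) j j = ((∑ i, ‖B i j‖ ^ 2 : ℝ) : ℂ) := by
    simp only [Matrix.mul_apply, Matrix.conjTranspose_apply, Complex.ofReal_sum]
    refine Finset.sum_congr rfl fun i _ => ?_
    have := Complex.conj_mul' (B i j)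
    simpa using this
  rw [Matrix.smul_apply, hsum, Matrix.sub_apply, Matrix.conjTranspose_apply] at hjj
  have him := congrArg Complex.im hjj
  have him2 : -(B j j).im = y.im * ∑ i, ‖B i j‖ ^ 2 := by
    generalize (∑ i, ‖B i j‖ ^ 2) = S at him ⊢
    rw [smul_eq_mul, Complex.im_mul_ofReal] at him
    simp at him
    linarith
  set S := ∑ i, ‖B i j‖ ^ 2 with hS
  have hS0 : 0 ≤ S := by positivity
  have hle : ∀ i, ‖B i j‖ ^ 2 ≤ S := fun i =>
    Finset.single_le_sum (f := fun i => ‖B i j‖ ^ 2) (fun i _ => by positivity) (Finset.mem_univ i)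
  have hpos : 0 < |y.im| := abs_pos.2 hy
  have h1 : |y.im| * S ≤ ‖B j j‖ := by
    rw [← abs_of_nonneg hS0, ← abs_mul, ← him2, abs_neg]
    exact Complex.abs_im_le_norm _
  have h2 : |y.im| * ‖B j j‖ ≤ 1 := by
    by_contra hcon
    push Not at hcon
    have := hle j
    have hb : 0 < ‖B j j‖ := by
      by_contra hb
      have : ‖B j j‖ = 0 := le_antisymm (not_lt.1 hb) (norm_nonneg _)
      rw [this] at hcon
      norm_num at hcon
    nlinarith
  have h3 : (|y.im| * ‖B i j‖) ^ 2 ≤ 1 := by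
    have := hle i
    have h4 : |y.im| * (|y.im| * S) ≤ |y.im| * ‖B j j‖ := by gcongr
    have h5 : |y.im| ^ 2 * ‖B i j‖ ^ 2 ≤ |y.im| ^ 2 * S := by gcongr
    rw [mul_pow]
    nlinarith
  have h4 : |y.im| * ‖B i j‖ ≤ 1 := by
    nlinarith
  rw [← one_div, le_div_iff₀ hpos]
  linarith

lemma sd_inv_continuous {X : Type*} [TopologicalSpace X] {N : ℕ}
    (M : X → HermMat N) (hM : Continuous fun q => (M q).1) (y : ℂ) (hy : y.im ≠ 0) :
    Continuous fun q => (y • (1 : Matrix (Fin N) (Fin N) ℂ) - (M q).1)⁻¹ := by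
  have hR : Continuous fun q => y • (1 : Matrix (Fin N) (Fin N) ℂ) - (M q).1 :=
    continuous_const.sub hM
  simp only [Matrix.inv_def, Ring.inverse_eq_inv']
  exact (hR.matrix_det.inv₀ fun q => sd_det_ne (M q) y hy).smul hR.matrix_adjugate

lemma SDGoodM.inv1 (N : ℕ) (y : ℂ) (hy : y.im ≠ 0) : SDGoodM
    (fun p : HermMat N × HermMat N => (y • (1 : Matrix (Fin N) (Fin N) ℂ) - p.1.1)⁻¹) :=
  fun i j => SDGood.of_bounded
    ((sd_inv_continuous (fun p : HermMat N × HermMat N => p.1)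
      (sd_continuous_fst N) y hy).matrix_elem i j) _
    fun p => sd_inv_bound p.1 y hy i j

lemma SDGoodM.inv2 (N : ℕ) (y : ℂ) (hy : y.im ≠ 0) : SDGoodM
    (fun p : HermMat N × HermMat N => (y • (1 : Matrix (Fin N) (Fin N) ℂ) - p.2.1)⁻¹) :=
  fun i j => SDGood.of_bounded
    ((sd_inv_continuous (fun p : HermMat N × HermMat N => p.2)
      (sd_continuous_snd N) y hy).matrix_elem i j) _
    fun p => sd_inv_bound p.2 y hy i j


lemma sd_spectral {N : ℕ} (M : HermMat N) : ∃ (U : Matrix (Fin N) (Fin N) ℂ) (l : Fin N → ℝ),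
    U * Uᴴ = 1 ∧ Uᴴ * U = 1 ∧ ∀ V : Polynomial ℝ, Polynomial.aeval M.1 V =
      U * diagonal (fun i => ((V.eval (l i) : ℝ) : ℂ)) * Uᴴ := by
  have hM : M.1.IsHermitian := M.2
  refine ⟨hM.eigenvectorUnitary, hM.eigenvalues, ?_, ?_, ?_⟩
  · exact (Matrix.mem_unitaryGroup_iff).1 hM.eigenvectorUnitary.2
  · exact (Matrix.mem_unitaryGroup_iff').1 hM.eigenvectorUnitary.2
  · have hU : (hM.eigenvectorUnitary : Matrix (Fin N) (Fin N) ℂ)ᴴ *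
        (hM.eigenvectorUnitary : Matrix (Fin N) (Fin N) ℂ) = 1 :=
      (Matrix.mem_unitaryGroup_iff').1 hM.eigenvectorUnitary.2
    have hU' : (hM.eigenvectorUnitary : Matrix (Fin N) (Fin N) ℂ) *
        (hM.eigenvectorUnitary : Matrix (Fin N) (Fin N) ℂ)ᴴ = 1 :=
      (Matrix.mem_unitaryGroup_iff).1 hM.eigenvectorUnitary.2
    have hs : M.1 = (hM.eigenvectorUnitary : Matrix (Fin N) (Fin N) ℂ) *
        diagonal (fun i => (hM.eigenvalues i : ℂ)) *
        (hM.eigenvectorUnitary : Matrix (Fin N) (Fin N) ℂ)ᴴ := hM.spectral_theorem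
    generalize (hM.eigenvectorUnitary : Matrix (Fin N) (Fin N) ℂ) = U at *
    generalize hM.eigenvalues = l at *
    have hpow : ∀ k : ℕ, M.1 ^ k = U * diagonal (fun i => ((l i : ℂ)) ^ k) * Uᴴ := by
      intro k
      induction k with
      | zero =>
        have : (diagonal fun _ : Fin N => (1 : ℂ)) = 1 := diagonal_one
        simp [this, hU']
      | succ k ih =>
        rw [pow_succ, ih]
        nth_rewrite 1 [hs]
        calc _ = U * diagonal (fun i => ((l i : ℂ)) ^ k) * (Uᴴ * U) *
              diagonal (fun i => (l i : ℂ)) * Uᴴ := by simp only [mul_assoc]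
          _ = _ := by
            rw [hU, mul_one, mul_assoc U, diagonal_mul_diagonal]
            simp only [pow_succ]
    intro V
    rw [sd_aeval_eq]
    have hd : diagonal (fun i => ((V.eval (l i) : ℝ) : ℂ)) =
        ∑ k ∈ Finset.range (V.natDegree + 1),
          (V.coeff k : ℂ) • diagonal (fun i => ((l i : ℂ)) ^ k) := by
      ext i j
      rw [Matrix.sum_apply]
      by_cases hij : i = j
      · subst hij
        simp [Polynomial.eval_eq_sum_range]
      · simp [hij]
    rw [hd, Finset.mul_sum, Finset.sum_mul]
    refine Finset.sum_congr rfl fun k _ => ?_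
    rw [hpow]; simp

lemma sdSize_eq {N : ℕ} (M : HermMat N) :
    ((sdSize M.1 : ℝ) : ℂ) = (M.1 * M.1).trace := by
  have hM : M.1ᴴ = M.1 := M.2
  nth_rewrite 3 [← hM]
  simp only [sdSize, Matrix.trace, Matrix.diag, Matrix.mul_apply, Matrix.conjTranspose_apply,
    Complex.ofReal_sum]
  refine Finset.sum_congr rfl fun i _ => Finset.sum_congr rfl fun j _ => ?_
  have := Complex.mul_conj' (M.1 i j)
  simpa using this.symm

lemma sd_conf {N : ℕ} (V₁ V₂ : Polynomial ℝ) (c C : ℝ)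
    (hc : ∀ x y : ℝ, c * (x ^ 2 + y ^ 2) - C ≤ V₁.eval x + V₂.eval y - x * y)
    (p : HermMat N × HermMat N) :
    ∃ r : ℝ, (Polynomial.aeval p.1.1 V₁ + Polynomial.aeval p.2.1 V₂ - p.1.1 * p.2.1).trace = r ∧
      c * sdSize2 p - C * N ≤ r := by
  obtain ⟨U, l, hU, hU', hUV⟩ := sd_spectral p.1
  obtain ⟨W, m, hW, hW', hWV⟩ := sd_spectral p.2
  set Q := Uᴴ * W with hQ
  have hQ1 : Q * Qᴴ = 1 := by
    rw [hQ, conjTranspose_mul, conjTranspose_conjTranspose]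
    calc _ = Uᴴ * (W * Wᴴ) * U := by simp only [mul_assoc]
      _ = 1 := by rw [hW, mul_one, hU']
  have hQ2 : Qᴴ * Q = 1 := by
    rw [hQ, conjTranspose_mul, conjTranspose_conjTranspose]
    calc _ = Wᴴ * (U * Uᴴ) * W := by simp only [mul_assoc]
      _ = 1 := by rw [hU, mul_one, hW']
  have hP1 : ∀ i, ∑ j, ‖Q i j‖ ^ 2 = 1 := fun i => by
    have h := congrFun (congrFun hQ1 i) i
    rw [Matrix.mul_apply, Matrix.one_apply_eq] at h
    have h2 : ((∑ j, ‖Q i j‖ ^ 2 : ℝ) : ℂ) = 1 := by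
      rw [← h, Complex.ofReal_sum]
      refine Finset.sum_congr rfl fun j _ => ?_
      have := Complex.mul_conj' (Q i j)
      simpa using this.symm
    exact_mod_cast h2
  have hP2 : ∀ j, ∑ i, ‖Q i j‖ ^ 2 = 1 := fun j => by
    have h := congrFun (congrFun hQ2 j) j
    rw [Matrix.mul_apply, Matrix.one_apply_eq] at h
    have h2 : ((∑ i, ‖Q i j‖ ^ 2 : ℝ) : ℂ) = 1 := by
      rw [← h, Complex.ofReal_sum]
      refine Finset.sum_congr rfl fun i _ => ?_
      have := Complex.conj_mul' (Q i j)
      simpa using this.symm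
    exact_mod_cast h2
  have ht1 : ∀ V : Polynomial ℝ, (Polynomial.aeval p.1.1 V).trace =
      ((∑ i, V.eval (l i) : ℝ) : ℂ) := fun V => by
    rw [hUV, Matrix.trace_mul_comm, ← mul_assoc, hU', one_mul, Matrix.trace_diagonal]
    simp
  have ht2 : ∀ V : Polynomial ℝ, (Polynomial.aeval p.2.1 V).trace =
      ((∑ i, V.eval (m i) : ℝ) : ℂ) := fun V => by
    rw [hWV, Matrix.trace_mul_comm, ← mul_assoc, hW', one_mul, Matrix.trace_diagonal]
    simp
  have hs1 : sdSize p.1.1 = ∑ i, l i ^ 2 := by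
    have h := ht1 (Polynomial.X ^ 2)
    rw [map_pow, Polynomial.aeval_X, sq, ← sdSize_eq] at h
    have h' := Complex.ofReal_injective h
    simpa using h'
  have hs2 : sdSize p.2.1 = ∑ i, m i ^ 2 := by
    have h := ht2 (Polynomial.X ^ 2)
    rw [map_pow, Polynomial.aeval_X, sq, ← sdSize_eq] at h
    have h' := Complex.ofReal_injective h
    simpa using h'
  have h12 : (p.1.1 * p.2.1).trace = ((∑ i, ∑ j, ‖Q i j‖ ^ 2 * (l i * m j) : ℝ) : ℂ) := by
    have h1 := hUV Polynomial.X
    have h2 := hWV Polynomial.X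
    simp only [Polynomial.aeval_X, Polynomial.eval_X] at h1 h2
    have e : (p.1.1 * p.2.1).trace = (diagonal (fun i => (l i : ℂ)) * (Q *
        diagonal (fun i => (m i : ℂ)) * Qᴴ)).trace := by
      rw [h1, h2, mul_assoc, mul_assoc, Matrix.trace_mul_comm, hQ, conjTranspose_mul,
        conjTranspose_conjTranspose]
      simp only [mul_assoc]
    rw [e]
    simp only [Matrix.trace, Matrix.diag, Matrix.diagonal_mul, Complex.ofReal_sum]
    refine Finset.sum_congr rfl fun i _ => ?_
    rw [Matrix.mul_apply, Finset.mul_sum]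
    refine Finset.sum_congr rfl fun j _ => ?_
    rw [Matrix.mul_diagonal, Matrix.conjTranspose_apply]
    have := Complex.mul_conj' (Q i j)
    push_cast
    rw [← this]
    simp only [Complex.star_def]
    ring
  refine ⟨∑ i, V₁.eval (l i) + ∑ j, V₂.eval (m j) - ∑ i, ∑ j, ‖Q i j‖ ^ 2 * (l i * m j), ?_, ?_⟩
  · rw [Matrix.trace_sub, Matrix.trace_add, ht1, ht2, h12]
    push_cast
    rfl
  · have hL : ∀ f : Fin N → ℝ, ∑ i, f i = ∑ i, ∑ j, ‖Q i j‖ ^ 2 * f i := fun f => by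
      simp only [← Finset.sum_mul, hP1, one_mul]
    have hR : ∀ f : Fin N → ℝ, ∑ j, f j = ∑ i, ∑ j, ‖Q i j‖ ^ 2 * f j := fun f => by
      rw [Finset.sum_comm]
      simp only [← Finset.sum_mul, hP2, one_mul]
    have hC : C * N = ∑ i, ∑ j, ‖Q i j‖ ^ 2 * C := by
      rw [← hL (fun _ => C)]; simp [mul_comm]
    unfold sdSize2
    rw [hs1, hs2, hC, mul_add, Finset.mul_sum, Finset.mul_sum, hL (fun i => c * l i ^ 2),
      hR (fun i => c * m i ^ 2), hL (fun i => V₁.eval (l i)), hR (fun i => V₂.eval (m i))]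
    simp only [← Finset.sum_add_distrib, ← Finset.sum_sub_distrib]
    refine Finset.sum_le_sum fun i _ => Finset.sum_le_sum fun j _ => ?_
    have := mul_le_mul_of_nonneg_left (hc (l i) (m j)) (sq_nonneg ‖Q i j‖)
    linarith

lemma sd_hweight_bound {N : ℕ} (hN : 1 ≤ N) (T : ℝ) (hT : 0 < T) (V₁ V₂ : Polynomial ℝ)
    (hconf : ∃ c > (0 : ℝ), ∃ C : ℝ, ∀ x y : ℝ,
      c * (x ^ 2 + y ^ 2) - C ≤ V₁.eval x + V₂.eval y - x * y) :
    ∃ a > (0 : ℝ), ∃ K : ℝ, 0 ≤ K ∧ ∀ p : HermMat N × HermMat N,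
      ‖hweight N T V₁ V₂ p.1.1 p.2.1‖ ≤ K * Real.exp (-a * sdSize2 p) := by
  obtain ⟨c, hc, C, h⟩ := hconf
  have hN' : (0 : ℝ) < N := by exact_mod_cast hN
  refine ⟨N / T * c, by positivity, Real.exp (N / T * (C * N)), by positivity, fun p => ?_⟩
  obtain ⟨r, hr, hle⟩ := sd_conf V₁ V₂ c C h p
  rw [hweight, hr, Complex.norm_exp, ← Real.exp_add]
  have e : (-((N : ℂ) / (T : ℂ)) * (r : ℂ)).re = -(N / T) * r := by
    rw [show -((N : ℂ) / (T : ℂ)) * (r : ℂ) = ((-(N / T) * r : ℝ) : ℂ) by push_cast; ring,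
      Complex.ofReal_re]
  rw [e]
  apply Real.exp_le_exp.2
  have : N / T * (c * sdSize2 p - C * N) ≤ N / T * r := by gcongr
  linarith

lemma sd_hweight_continuous (N : ℕ) (T : ℝ) (V₁ V₂ : Polynomial ℝ) :
    Continuous fun p : HermMat N × HermMat N => hweight N T V₁ V₂ p.1.1 p.2.1 := by
  have h : SDGood fun p : HermMat N × HermMat N =>
      (Polynomial.aeval p.1.1 V₁ + Polynomial.aeval p.2.1 V₂ - p.1.1 * p.2.1).trace :=
    ((((SDGoodM.fst N).aeval V₁).add ((SDGoodM.snd N).aeval V₂)).sub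
      ((SDGoodM.fst N).mul (SDGoodM.snd N))).trace
  exact Complex.continuous_exp.comp (continuous_const.mul h.1)

lemma SDGood.integrable {N : ℕ} (hN : 1 ≤ N) (T : ℝ) (hT : 0 < T) (V₁ V₂ : Polynomial ℝ)
    (hconf : ∃ c > (0 : ℝ), ∃ C : ℝ, ∀ x y : ℝ,
      c * (x ^ 2 + y ^ 2) - C ≤ V₁.eval x + V₂.eval y - x * y)
    [MeasurableSpace (HermMat N)] [BorelSpace (HermMat N)]
    (μ : Measure (HermMat N)) [μ.IsAddHaarMeasure] {f : HermMat N × HermMat N → ℂ}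
    (hf : SDGood f) :
    Integrable (fun p => f p * hweight N T V₁ V₂ p.1.1 p.2.1) (μ.prod μ) := by
  obtain ⟨a, ha, K, hK, hb⟩ := sd_hweight_bound hN T hT V₁ V₂ hconf
  obtain ⟨hc, L, k, hL, hbf⟩ := hf
  refine sd_integrable_herm μ _ (hc.mul (sd_hweight_continuous N T V₁ V₂)) a ha (L * K)
    (by positivity) k fun p => ?_
  have := sdSize2_nonneg p
  rw [norm_mul]
  calc _ ≤ L * (1 + sdSize2 p) ^ k * (K * Real.exp (-a * sdSize2 p)) :=
        mul_le_mul (hbf p) (hb p) (norm_nonneg _) (by positivity)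
    _ = _ := by ring

/-- Entrywise derivative of a matrix curve at `0`. -/
def SDDeriv {N : ℕ} (F : ℝ → Matrix (Fin N) (Fin N) ℂ) (F' : Matrix (Fin N) (Fin N) ℂ) : Prop :=
  ∀ i j, HasDerivAt (fun t => F t i j) (F' i j) 0

lemma SDDeriv.const {N : ℕ} (A : Matrix (Fin N) (Fin N) ℂ) : SDDeriv (fun _ => A) 0 :=
  fun _ _ => hasDerivAt_const _ _

lemma SDDeriv.mul {N : ℕ} {F G : ℝ → Matrix (Fin N) (Fin N) ℂ}
    {F' G' : Matrix (Fin N) (Fin N) ℂ} (hF : SDDeriv F F') (hG : SDDeriv G G') :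
    SDDeriv (fun t => F t * G t) (F' * G 0 + F 0 * G') := fun i j => by
  simp only [Matrix.mul_apply, Matrix.add_apply, ← Finset.sum_add_distrib]
  exact HasDerivAt.fun_sum fun k _ => (hF i k).mul (hG k j)

lemma SDDeriv.trace {N : ℕ} {F : ℝ → Matrix (Fin N) (Fin N) ℂ}
    {F' : Matrix (Fin N) (Fin N) ℂ} (hF : SDDeriv F F') :
    HasDerivAt (fun t => (F t).trace) F'.trace 0 :=
  HasDerivAt.fun_sum fun k _ => hF k k

lemma SDDeriv.line {N : ℕ} (M h : Matrix (Fin N) (Fin N) ℂ) :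
    SDDeriv (fun t : ℝ => M + t • h) h := fun i j => by
  have h1 : HasDerivAt (fun t : ℝ => t • h i j) ((1 : ℝ) • h i j) 0 :=
    (hasDerivAt_id (0 : ℝ)).smul_const (h i j)
  rw [one_smul] at h1
  exact h1.const_add (M i j)

lemma SDDeriv.pow {N : ℕ} (M h : Matrix (Fin N) (Fin N) ℂ) (k : ℕ) :
    SDDeriv (fun t : ℝ => (M + t • h) ^ k)
      (∑ l ∈ Finset.range k, M ^ l * h * M ^ (k - 1 - l)) := by
  induction k with
  | zero => simpa using SDDeriv.const 1
  | succ k ih =>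
    have h1 := ih.mul (SDDeriv.line M h)
    simp only [pow_succ]
    convert h1 using 1
    rw [Finset.sum_range_succ, Finset.sum_mul]
    congr 1
    · refine Finset.sum_congr rfl fun l hl => ?_
      have hl := Finset.mem_range.1 hl
      rw [zero_smul, add_zero, mul_assoc _ _ M, ← pow_succ]
      congr 2
      omega
    · simp

lemma sd_trace_pow_deriv {N : ℕ} (M h : Matrix (Fin N) (Fin N) ℂ) (k : ℕ) :
    HasDerivAt (fun t : ℝ => ((M + t • h) ^ k).trace) (k * (h * M ^ (k - 1)).trace) 0 := by
  convert (SDDeriv.pow M h k).trace using 1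
  rw [Matrix.trace_sum]
  rw [Finset.sum_congr rfl (g := fun _ => (h * M ^ (k - 1)).trace)]
  · simp
  · intro l hl
    have hl := Finset.mem_range.1 hl
    rw [mul_assoc, Matrix.trace_mul_comm, mul_assoc, ← pow_add]
    congr 3
    omega

lemma sd_trace_aeval_deriv {N : ℕ} (V : Polynomial ℝ) (M h : Matrix (Fin N) (Fin N) ℂ) :
    HasDerivAt (fun t : ℝ => (Polynomial.aeval (M + t • h) V).trace)
      (h * Polynomial.aeval M V.derivative).trace 0 := by
  induction V using Polynomial.induction_on' with
  | add p q hp hq =>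
    simp only [map_add, Matrix.trace_add, mul_add]
    exact hp.add hq
  | monomial k a =>
    rw [Polynomial.derivative_monomial]
    simp only [Polynomial.aeval_monomial, Algebra.algebraMap_eq_smul_one, smul_mul_assoc, one_mul,
      Matrix.trace_smul, mul_smul_comm]
    have h1 := (sd_trace_pow_deriv M h k).const_smul a
    have e : (a * (k : ℝ)) • (h * M ^ (k - 1)).trace =
        a • ((k : ℂ) * (h * M ^ (k - 1)).trace) := by
      rw [mul_smul]
      congr 1
    rw [e]
    exact h1

lemma sd_inv_deriv {N : ℕ} (M h : HermMat N) (y : ℂ) (hy : y.im ≠ 0) :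
    SDDeriv (fun t : ℝ => (y • (1 : Matrix (Fin N) (Fin N) ℂ) - (M.1 + t • h.1))⁻¹)
      ((y • (1 : Matrix (Fin N) (Fin N) ℂ) - M.1)⁻¹ * h.1 *
        (y • (1 : Matrix (Fin N) (Fin N) ℂ) - M.1)⁻¹) := fun i j => by
  set B : ℝ → Matrix (Fin N) (Fin N) ℂ :=
    fun t => (y • (1 : Matrix (Fin N) (Fin N) ℂ) - (M.1 + t • h.1))⁻¹ with hB
  have hcont : Continuous B := by
    refine sd_inv_continuous (fun t : ℝ => M + t • h) ?_ y hy
    exact continuous_const.add (continuous_id.smul continuous_const)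
  have hB0 : (y • (1 : Matrix (Fin N) (Fin N) ℂ) - M.1)⁻¹ = B 0 := by simp [hB]
  have key : ∀ t, B t - B 0 = t • (B t * h.1 * B 0) := fun t => by
    have hu : IsUnit (y • (1 : Matrix (Fin N) (Fin N) ℂ) - (M.1 + t • h.1)).det :=
      (sd_det_ne (M + t • h) y hy).isUnit
    have hu0 : IsUnit (y • (1 : Matrix (Fin N) (Fin N) ℂ) - M.1).det := (sd_det_ne M y hy).isUnit
    have e1 : B t * (y • (1 : Matrix (Fin N) (Fin N) ℂ) - (M.1 + t • h.1)) = 1 :=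
      Matrix.nonsing_inv_mul _ hu
    have e2 : (y • (1 : Matrix (Fin N) (Fin N) ℂ) - M.1) * B 0 = 1 := by
      rw [← hB0]; exact Matrix.mul_nonsing_inv _ hu0
    have e3 : t • h.1 = (y • (1 : Matrix (Fin N) (Fin N) ℂ) - M.1) -
      (y • (1 : Matrix (Fin N) (Fin N) ℂ) - (M.1 + t • h.1)) := by abel
    calc B t - B 0 = B t * (t • h.1) * B 0 := by
          rw [e3, mul_sub, sub_mul, e1, mul_assoc, e2, mul_one, one_mul]
      _ = _ := by simp
  rw [hB0, hasDerivAt_iff_tendsto_slope]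
  have hc2 : Continuous fun t => (B t * h.1 * B 0) i j :=
    ((hcont.matrix_mul continuous_const).matrix_mul continuous_const).matrix_elem i j
  have h2 := (hc2.tendsto 0).mono_left (nhdsWithin_le_nhds (s := {0}ᶜ))
  refine h2.congr' ?_
  filter_upwards [self_mem_nhdsWithin] with t ht
  have ht0 : t ≠ 0 := ht
  have hk := congrFun (congrFun (key t) i) j
  rw [slope_def_module, sub_zero]
  rw [Matrix.sub_apply, Matrix.smul_apply] at hk
  rw [hk, smul_smul, inv_mul_cancel₀ ht0, one_smul]


lemma sd_SV_mul {N : ℕ} (V : Polynomial ℝ) (y : ℂ) (M : Matrix (Fin N) (Fin N) ℂ) :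
    SVmat V y M * (y • (1 : Matrix (Fin N) (Fin N) ℂ) - M) =
      (Polynomial.aeval y V.derivative) • (1 : Matrix (Fin N) (Fin N) ℂ) -
        Polynomial.aeval M V.derivative := by
  rw [sd_aeval_eq, Polynomial.aeval_eq_sum_range, Finset.sum_smul, ← Finset.sum_sub_distrib,
    SVmat, Finset.sum_mul]
  refine Finset.sum_congr rfl fun k _ => ?_
  have hc : Commute (y • (1 : Matrix (Fin N) (Fin N) ℂ)) M := (Commute.one_left M).smul_left y
  have h := hc.geom_sum₂_mul k
  have e : ∀ l : ℕ, (y • (1 : Matrix (Fin N) (Fin N) ℂ)) ^ l = y ^ l • 1 := fun l => by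
    rw [smul_pow, one_pow]
  simp only [e, smul_mul_assoc, one_mul] at h
  rw [smul_mul_assoc, h, smul_sub, smul_smul]
  rfl

lemma sd_hweight_deriv {N : ℕ} (T : ℝ) (V₁ V₂ : Polynomial ℝ) (M₁ M₂ h : Matrix (Fin N) (Fin N) ℂ) :
    HasDerivAt (fun t : ℝ => hweight N T V₁ V₂ M₁ (M₂ + t • h))
      (hweight N T V₁ V₂ M₁ M₂ * (-((N : ℂ) / (T : ℂ)) *
        (h * (Polynomial.aeval M₂ V₂.derivative - M₁)).trace)) 0 := by
  have h1 := sd_trace_aeval_deriv V₂ M₂ h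
  have h2 := ((SDDeriv.const M₁).mul (SDDeriv.line M₂ h)).trace
  have h3 := ((h1.const_add (Polynomial.aeval M₁ V₁).trace).sub h2).const_mul
    (-((N : ℂ) / (T : ℂ)))
  have h4 := h3.cexp
  have e : (h * (Polynomial.aeval M₂ V₂.derivative - M₁)).trace =
      (h * Polynomial.aeval M₂ V₂.derivative).trace -
        ((0 : Matrix (Fin N) (Fin N) ℂ) * (M₂ + (0 : ℝ) • h) + M₁ * h).trace := by
    rw [mul_sub, Matrix.trace_sub, zero_mul, zero_add, Matrix.trace_mul_comm M₁ h]
  rw [e]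
  have e0 : hweight N T V₁ V₂ M₁ M₂ = hweight N T V₁ V₂ M₁ (M₂ + (0 : ℝ) • h) := by simp
  rw [e0]
  unfold hweight
  simp only [Matrix.trace_sub, Matrix.trace_add] at h4 ⊢
  exact h4

/-- The integrand (without weight) obtained by differentiating in direction `h`. -/
noncomputable def sdL {N : ℕ} (T : ℝ) (V₂ : Polynomial ℝ) (x y : ℂ) (i j : Fin N)
    (h : Matrix (Fin N) (Fin N) ℂ) (p : HermMat N × HermMat N) : ℂ :=
  ((y • (1 : Matrix (Fin N) (Fin N) ℂ) - p.2.1)⁻¹ * h *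
      ((y • (1 : Matrix (Fin N) (Fin N) ℂ) - p.2.1)⁻¹ *
        (x • (1 : Matrix (Fin N) (Fin N) ℂ) - p.1.1)⁻¹)) i j +
    (-((N : ℂ) / (T : ℂ))) * (((y • (1 : Matrix (Fin N) (Fin N) ℂ) - p.2.1)⁻¹ *
        (x • (1 : Matrix (Fin N) (Fin N) ℂ) - p.1.1)⁻¹) i j *
      (h * (Polynomial.aeval p.2.1 V₂.derivative - p.1.1)).trace)

lemma sdL_good {N : ℕ} (T : ℝ) (V₂ : Polynomial ℝ) (x y : ℂ) (hx : x.im ≠ 0) (hy : y.im ≠ 0)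
    (i j : Fin N) (h : Matrix (Fin N) (Fin N) ℂ) : SDGood (sdL T V₂ x y i j h) := by
  have hA := SDGoodM.inv1 N x hx
  have hB := SDGoodM.inv2 N y hy
  have h1 := ((hB.mul (SDGoodM.const h)).mul (hB.mul hA)) i j
  have h2 := (SDGood.const (N := N) (-((N : ℂ) / (T : ℂ)))).mul (((hB.mul hA) i j).mul
    ((SDGoodM.const h).mul (((SDGoodM.snd N).aeval V₂.derivative).sub (SDGoodM.fst N))).trace)
  exact h1.add h2

lemma sdL_add {N : ℕ} (T : ℝ) (V₂ : Polynomial ℝ) (x y c : ℂ) (i j : Fin N)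
    (h h' : Matrix (Fin N) (Fin N) ℂ) (p : HermMat N × HermMat N) :
    sdL T V₂ x y i j (h + c • h') p = sdL T V₂ x y i j h p + c * sdL T V₂ x y i j h' p := by
  unfold sdL
  simp only [mul_add, add_mul, Matrix.add_apply, Matrix.trace_add, mul_smul_comm, smul_mul_assoc,
    Matrix.smul_apply, Matrix.trace_smul, smul_eq_mul]
  ring

section Main

variable {N : ℕ} (hN : 1 ≤ N) (T : ℝ) (hT : 0 < T) (V₁ V₂ : Polynomial ℝ)
    (hconf : ∃ c > (0 : ℝ), ∃ C : ℝ, ∀ x y : ℝ,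
      c * (x ^ 2 + y ^ 2) - C ≤ V₁.eval x + V₂.eval y - x * y)
    [MeasurableSpace (HermMat N)] [BorelSpace (HermMat N)]
    (μ : Measure (HermMat N)) [μ.IsAddHaarMeasure] (x y : ℂ) (hx : x.im ≠ 0) (hy : y.im ≠ 0)

lemma sd_ibp1 (hN : 1 ≤ N) (hT : 0 < T)
    (hconf : ∃ c > (0 : ℝ), ∃ C : ℝ, ∀ x y : ℝ,
      c * (x ^ 2 + y ^ 2) - C ≤ V₁.eval x + V₂.eval y - x * y)
    (hx : x.im ≠ 0) (hy : y.im ≠ 0) (i j : Fin N) (h : HermMat N) :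
    ∫ p : HermMat N × HermMat N, sdL T V₂ x y i j h.1 p *
      hweight N T V₁ V₂ p.1.1 p.2.1 ∂(μ.prod μ) = 0 := by
  have hA := SDGoodM.inv1 N x hx
  have hB := SDGoodM.inv2 N y hy
  refine sd_ibp_herm μ (fun p => ((y • (1 : Matrix (Fin N) (Fin N) ℂ) - p.2.1)⁻¹ *
        (x • (1 : Matrix (Fin N) (Fin N) ℂ) - p.1.1)⁻¹) i j * hweight N T V₁ V₂ p.1.1 p.2.1)
    _ (0, h) (((hB.mul hA) i j).integrable hN T hT V₁ V₂ hconf μ)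
    ((sdL_good T V₂ x y hx hy i j h.1).integrable hN T hT V₁ V₂ hconf μ) fun p => ?_
  have e : ∀ t : ℝ, p + t • ((0, h) : HermMat N × HermMat N) = (p.1, p.2 + t • h) := fun t => by
    ext1 <;> simp
  let F : HermMat N × HermMat N → ℂ :=
    fun p => ((y • (1 : Matrix (Fin N) (Fin N) ℂ) - p.2.1)⁻¹ *
        (x • (1 : Matrix (Fin N) (Fin N) ℂ) - p.1.1)⁻¹) i j * hweight N T V₁ V₂ p.1.1 p.2.1
  suffices hs : HasDerivAt (fun t : ℝ => F (p.1, p.2 + t • h))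
      (sdL T V₂ x y i j h.1 p * hweight N T V₁ V₂ p.1.1 p.2.1) 0 by
    simp only [← e] at hs
    exact hs
  have h1 := ((sd_inv_deriv p.2 h y hy).mul
    (SDDeriv.const (x • (1 : Matrix (Fin N) (Fin N) ℂ) - p.1.1)⁻¹)) i j
  have h2 := h1.mul (sd_hweight_deriv T V₁ V₂ p.1.1 p.2.1 h.1)
  refine h2.congr_deriv ?_
  simp only [zero_smul, add_zero, mul_zero]
  unfold sdL
  simp only [mul_assoc]
  ring

lemma sd_ibp2 (hN : 1 ≤ N) (hT : 0 < T)
    (hconf : ∃ c > (0 : ℝ), ∃ C : ℝ, ∀ x y : ℝ,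
      c * (x ^ 2 + y ^ 2) - C ≤ V₁.eval x + V₂.eval y - x * y)
    (hx : x.im ≠ 0) (hy : y.im ≠ 0) (i j : Fin N) (h : Matrix (Fin N) (Fin N) ℂ) :
    ∫ p : HermMat N × HermMat N, sdL T V₂ x y i j h p *
      hweight N T V₁ V₂ p.1.1 p.2.1 ∂(μ.prod μ) = 0 := by
  rw [← realPart_add_I_smul_imaginaryPart h]
  simp only [sdL_add, add_mul, mul_assoc]
  rw [integral_add ((sdL_good T V₂ x y hx hy i j _).integrable hN T hT V₁ V₂ hconf μ)
    (((sdL_good T V₂ x y hx hy i j _).integrable hN T hT V₁ V₂ hconf μ).const_mul _),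
    integral_const_mul, sd_ibp1 T V₁ V₂ μ x y hN hT hconf hx hy,
    sd_ibp1 T V₁ V₂ μ x y hN hT hconf hx hy]
  simp

lemma sd_sum_identity (x y : ℂ) (hx : x.im ≠ 0) (hy : y.im ≠ 0) (p : HermMat N × HermMat N) :
    ∑ i, ∑ j, sdL T V₂ x y i j (Matrix.single i j 1) p =
      ((x • (1 : Matrix (Fin N) (Fin N) ℂ) - p.1.1)⁻¹ *
        (y • (1 : Matrix (Fin N) (Fin N) ℂ) - p.2.1)⁻¹).trace *
        ((y • (1 : Matrix (Fin N) (Fin N) ℂ) - p.2.1)⁻¹).trace +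
      (-((N : ℂ) / (T : ℂ))) * ((Polynomial.aeval y V₂.derivative - x) *
        ((x • (1 : Matrix (Fin N) (Fin N) ℂ) - p.1.1)⁻¹ *
          (y • (1 : Matrix (Fin N) (Fin N) ℂ) - p.2.1)⁻¹).trace +
        (((y • (1 : Matrix (Fin N) (Fin N) ℂ) - p.2.1)⁻¹).trace +
          (-1) * ((x • (1 : Matrix (Fin N) (Fin N) ℂ) - p.1.1)⁻¹ * SVmat V₂ y p.2.1).trace)) := by
  have hu : IsUnit (y • (1 : Matrix (Fin N) (Fin N) ℂ) - p.2.1).det := (sd_det_ne _ y hy).isUnit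
  have hv : IsUnit (x • (1 : Matrix (Fin N) (Fin N) ℂ) - p.1.1).det := (sd_det_ne _ x hx).isUnit
  have hS := sd_SV_mul V₂ y p.2.1
  have hB := Matrix.mul_nonsing_inv _ hu
  have hA := Matrix.nonsing_inv_mul _ hv
  unfold sdL
  generalize (y • (1 : Matrix (Fin N) (Fin N) ℂ) - p.2.1)⁻¹ = B at *
  generalize (x • (1 : Matrix (Fin N) (Fin N) ℂ) - p.1.1)⁻¹ = A at *
  have hAM : A * p.1.1 = x • A - 1 := by
    rw [← hA, mul_sub]; simp
  have hVB : Polynomial.aeval p.2.1 V₂.derivative * B =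
      Polynomial.aeval y V₂.derivative • B - SVmat V₂ y p.2.1 := by
    have : SVmat V₂ y p.2.1 = SVmat V₂ y p.2.1 * (y • (1 : Matrix (Fin N) (Fin N) ℂ) - p.2.1) * B
      := by rw [mul_assoc, hB, mul_one]
    rw [this, hS, sub_mul]; simp
  generalize Polynomial.aeval p.2.1 V₂.derivative = D at *
  have t1 : ∀ i j, (B * Matrix.single i j (1 : ℂ) * (B * A) : Matrix (Fin N) (Fin N) ℂ) i j = B i i * (B * A) j j := fun i j => by
    rw [mul_assoc, Matrix.mul_apply, Finset.sum_eq_single i]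
    · simp
    · intro k _ hk
      simp [hk.symm, Matrix.mul_apply]
    · simp
  have t2 : ∀ i j, (Matrix.single i j 1 * (D - p.1.1)).trace = (D - p.1.1) j i := fun i j => by
    simp [Matrix.trace_single_mul]
  simp only [t1, t2, Finset.sum_add_distrib, ← Finset.mul_sum, ← Finset.sum_mul]
  have t3 : ∑ i, ∑ j, (B * A) i j * (D - p.1.1) j i = (B * A * (D - p.1.1)).trace := by
    simp only [Matrix.trace, Matrix.diag, Matrix.mul_apply (M := B * A)]
  rw [t3]
  have t4 : (B * A * (D - p.1.1)).trace = (A * (D * B)).trace - (B * (A * p.1.1)).trace := by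
    rw [mul_sub, Matrix.trace_sub, mul_assoc, Matrix.trace_mul_comm B, mul_assoc, mul_assoc]
  rw [t4, hAM, hVB]
  simp only [mul_sub, Matrix.trace_sub, mul_smul_comm, Matrix.trace_smul, mul_one, smul_eq_mul]
  rw [Matrix.trace_mul_comm B A]
  have t5 : ∑ j, (B * A) j j = (A * B).trace := by rw [Matrix.trace_mul_comm A B]; rfl
  have t6 : ∑ i, B i i = B.trace := rfl
  rw [t5, t6]
  ring

end Main

lemma sd_integral_split {X : Type*} [MeasurableSpace X] (ν : Measure X) {f g h k : X → ℂ}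
    (hf : Integrable f ν) (hg : Integrable g ν) (hh : Integrable h ν) (hk : Integrable k ν)
    {a b c : ℂ} : ∫ p, (f p + (a * (b * g p) + (a * h p + a * (c * k p)))) ∂ν =
      ∫ p, f p ∂ν + (a * (b * ∫ p, g p ∂ν) + (a * ∫ p, h p ∂ν + a * (c * ∫ p, k p ∂ν))) := by
  have h1 : Integrable (fun p => a * (b * g p)) ν := (hg.const_mul _).const_mul _
  have h2 : Integrable (fun p => a * h p) ν := hh.const_mul _
  have h3 : Integrable (fun p => a * (c * k p)) ν := (hk.const_mul _).const_mul _
  have h4 : Integrable (fun p => a * h p + a * (c * k p)) ν := h2.add h3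
  have h5 : Integrable (fun p => a * (b * g p) + (a * h p + a * (c * k p))) ν := h1.add h4
  rw [integral_add hf h5, integral_add h1 h4, integral_add h2 h3]
  simp only [integral_const_mul]

end SDHelpers

theorem schwinger_dyson_mixed_two_point
    (N : ℕ) (hN : 1 ≤ N) (T : ℝ) (hT : 0 < T) (V₁ V₂ : Polynomial ℝ)
    (hconf : ∃ c > (0 : ℝ), ∃ C : ℝ, ∀ x y : ℝ,
      c * (x ^ 2 + y ^ 2) - C ≤ V₁.eval x + V₂.eval y - x * y)
    [MeasurableSpace (HermMat N)] [BorelSpace (HermMat N)]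
    (μ : Measure (HermMat N)) [μ.IsAddHaarMeasure] :
    ∀ x y : ℂ, x.im ≠ 0 → y.im ≠ 0 →
      (x - Polynomial.aeval y V₂.derivative + (T : ℂ) * resolvent2 N T V₁ V₂ μ y) *
          W12 N T V₁ V₂ μ x y +
        ((T : ℂ) / (N : ℂ) ^ 2) * W122 N T V₁ V₂ μ x y y
      = resolvent2 N T V₁ V₂ μ y - Ufun N T V₁ V₂ μ x y := by
  intro x y hx hy
  have hN0 : (N : ℂ) ≠ 0 := by
    have : N ≠ 0 := by omega
    exact_mod_cast this
  have hT0 : (T : ℂ) ≠ 0 := by exact_mod_cast hT.ne'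
  have hA := SDGoodM.inv1 N x hx
  have hB := SDGoodM.inv2 N y hy
  have hS := (SDGoodM.snd N).SV V₂ y
  have iAB := (hA.mul hB).trace.integrable hN T hT V₁ V₂ hconf μ
  have iABB := ((hA.mul hB).trace.mul hB.trace).integrable hN T hT V₁ V₂ hconf μ
  have iB := hB.trace.integrable hN T hT V₁ V₂ hconf μ
  have iAS := (hA.mul hS).trace.integrable hN T hT V₁ V₂ hconf μ
  have hzero : ∫ p : HermMat N × HermMat N,
      (∑ i, ∑ j, sdL T V₂ x y i j (Matrix.single i j 1) p) *
        hweight N T V₁ V₂ p.1.1 p.2.1 ∂(μ.prod μ) = 0 := by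
    simp only [Finset.sum_mul]
    have hint := fun i j : Fin N => (sdL_good T V₂ x y hx hy i j
      (Matrix.single i j 1)).integrable hN T hT V₁ V₂ hconf μ
    rw [integral_finsetSum _ fun i _ => integrable_finsetSum _ fun j _ => hint i j]
    refine Finset.sum_eq_zero fun i _ => ?_
    rw [integral_finsetSum _ fun j _ => hint i j]
    exact Finset.sum_eq_zero fun j _ => sd_ibp2 T V₁ V₂ μ x y hN hT hconf hx hy i j _
  simp only [sd_sum_identity T V₂ x y hx hy, add_mul, mul_assoc, mul_add] at hzero
  simp only [mul_assoc] at iABB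
  rw [sd_integral_split _ iABB iAB iB iAS] at hzero
  unfold W122 W12 Ufun resolvent2 expectation
  simp only [mul_assoc] at hzero ⊢
  generalize (∫ p : HermMat N × HermMat N, hweight N T V₁ V₂ p.1.1 p.2.1 ∂(μ.prod μ))⁻¹ = Z
  have key := congrArg (fun w => (T : ℂ) / (N : ℂ) ^ 2 * Z * w) hzero
  simp only [mul_zero] at key
  field_simp at key ⊢
  linear_combination key
end

section
/- Loop equation for the mixed correlation function (exact finite-N form): for every x ∈ ℂ with Im x ≠ 0 and every y ∈ ℂ with Im y ≠ 0 such that x ≠ X(y) and y ≠ Y(x), one has T·W_{1,2}(x,y) = 1 − E(x,y)/((x−X(y))·(y−Y(x))) + (T²/N²)·( U(x,y;x)/((x−X(y))·(y−Y(x))) − W_{1,2;2}(x,y;y)/(x−X(y)) ). -/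
open MeasureTheory Matrix

noncomputable section

/-- The resolvent `W₁(x) = (1/N)⟨Tr (x·1 - M₁)⁻¹⟩`. -/
def resolvent1 (N : ℕ) (T : ℝ) (V₁ V₂ : Polynomial ℝ)
    [MeasurableSpace (HermMat N)] (μ : Measure (HermMat N)) (x : ℂ) : ℂ :=
  (1 / (N : ℂ)) * expectation N T V₁ V₂ μ fun M₁ _ =>
    ((x • (1 : Matrix (Fin N) (Fin N) ℂ) - M₁)⁻¹).trace

/-- `Y(x) = V₁'(x) - T·W₁(x)`. -/
def Yfun (N : ℕ) (T : ℝ) (V₁ V₂ : Polynomial ℝ)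
    [MeasurableSpace (HermMat N)] (μ : Measure (HermMat N)) (x : ℂ) : ℂ :=
  Polynomial.aeval x V₁.derivative - (T : ℂ) * resolvent1 N T V₁ V₂ μ x

/-- `X(y) = V₂'(y) - T·W₂(y)`. -/
def Xfun (N : ℕ) (T : ℝ) (V₁ V₂ : Polynomial ℝ)
    [MeasurableSpace (HermMat N)] (μ : Measure (HermMat N)) (y : ℂ) : ℂ :=
  Polynomial.aeval y V₂.derivative - (T : ℂ) * resolvent2 N T V₁ V₂ μ y

/-- `P(x,y) = (1/N)⟨Tr(S_{V₁}(x,M₁) S_{V₂}(y,M₂))⟩`. -/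
def Pfun (N : ℕ) (T : ℝ) (V₁ V₂ : Polynomial ℝ)
    [MeasurableSpace (HermMat N)] (μ : Measure (HermMat N)) (x y : ℂ) : ℂ :=
  (1 / (N : ℂ)) * expectation N T V₁ V₂ μ fun M₁ M₂ =>
    ((SVmat V₁ x M₁ * SVmat V₂ y M₂)).trace

/-- The connected correlator `U(x,y;x')`. -/
def Uconn (N : ℕ) (T : ℝ) (V₁ V₂ : Polynomial ℝ)
    [MeasurableSpace (HermMat N)] (μ : Measure (HermMat N)) (x y x' : ℂ) : ℂ :=
  expectation N T V₁ V₂ μ (fun M₁ M₂ =>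
      (((x • (1 : Matrix (Fin N) (Fin N) ℂ) - M₁)⁻¹ * SVmat V₂ y M₂)).trace *
        ((x' • (1 : Matrix (Fin N) (Fin N) ℂ) - M₁)⁻¹).trace)
    - (N : ℂ) ^ 2 * Ufun N T V₁ V₂ μ x y * resolvent1 N T V₁ V₂ μ x'

/-- `E(x,y) = (V₁'(x)-y)(V₂'(y)-x) - T·P(x,y) + T`. -/
def Efun (N : ℕ) (T : ℝ) (V₁ V₂ : Polynomial ℝ)
    [MeasurableSpace (HermMat N)] (μ : Measure (HermMat N)) (x y : ℂ) : ℂ :=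
  (Polynomial.aeval x V₁.derivative - y) * (Polynomial.aeval y V₂.derivative - x)
    - (T : ℂ) * Pfun N T V₁ V₂ μ x y + (T : ℂ)

end



@[reducible] noncomputable def hermBase (N : ℕ) : NormedAddCommGroup (HermMat N) :=
  @AddSubgroup.normedAddCommGroup _ Matrix.normedAddCommGroup _

@[reducible] noncomputable def hermMetric (N : ℕ) : MetricSpace (HermMat N) :=
  (hermBase N).toMetricSpace.replaceTopology rfl

noncomputable instance hermNormed (N : ℕ) : NormedAddCommGroup (HermMat N) :=
  { hermMetric N with
    norm := (hermBase N).norm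
    dist_eq := (hermBase N).dist_eq }


noncomputable instance hermNormedSpace (N : ℕ) : NormedSpace ℝ (HermMat N) where
  norm_smul_le a b := by
    letI : NormedAddCommGroup (Matrix (Fin N) (Fin N) ℂ) := Matrix.normedAddCommGroup
    letI : NormedSpace ℝ (Matrix (Fin N) (Fin N) ℂ) := Matrix.normedSpace
    exact norm_smul_le a b.1

lemma herm_norm_le_iff {N : ℕ} (M : HermMat N) {r : ℝ} (hr : 0 ≤ r) :
    ‖M‖ ≤ r ↔ ∀ i j, ‖M.1 i j‖ ≤ r :=
  Matrix.norm_le_iff (A := M.1) hr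

def hermIncl (N : ℕ) : HermMat N →ₗ[ℝ] Matrix (Fin N) (Fin N) ℂ where
  toFun b := b.1
  map_add' _ _ := rfl
  map_smul' _ _ := rfl

instance hermFin (N : ℕ) : FiniteDimensional ℝ (HermMat N) :=
  FiniteDimensional.of_injective (hermIncl N) Subtype.val_injective

instance hermProper (N : ℕ) : ProperSpace (HermMat N) := FiniteDimensional.proper ℝ _

instance hermSecond (N : ℕ) : SecondCountableTopology (HermMat N) := by
  have := hermProper N
  exact secondCountable_of_proper

instance hermSigma (N : ℕ) : SigmaCompactSpace (HermMat N) := by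
  have := hermProper N
  exact sigmaCompactSpace_of_locallyCompact_secondCountable

instance hermSFinite (N : ℕ) [MeasurableSpace (HermMat N)] [BorelSpace (HermMat N)]
    (μ : Measure (HermMat N)) [μ.IsAddHaarMeasure] : SigmaFinite μ := by
  have := hermSigma N
  exact MeasureTheory.Measure.IsAddHaarMeasure.sigmaFinite μ

instance hermProdHaar (N : ℕ) [MeasurableSpace (HermMat N)] [BorelSpace (HermMat N)]
    (μ : Measure (HermMat N)) [μ.IsAddHaarMeasure] : (μ.prod μ).IsAddHaarMeasure := by
  infer_instance

instance hermProdBorel (N : ℕ) [MeasurableSpace (HermMat N)] [BorelSpace (HermMat N)] :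
    BorelSpace (HermMat N × HermMat N) := by
  infer_instance

section linalg
variable {N : ℕ}

lemma herm_isHerm (M : HermMat N) : M.1.IsHermitian := M.2

lemma res_isUnit (M : HermMat N) {x : ℂ} (hx : x.im ≠ 0) :
    IsUnit (x • (1 : Matrix (Fin N) (Fin N) ℂ) - M.1).det := by
  rw [isUnit_iff_ne_zero]
  intro h
  obtain ⟨v, hv, h0⟩ := Matrix.exists_mulVec_eq_zero_iff.mpr h
  rw [Matrix.sub_mulVec, Matrix.smul_mulVec, Matrix.one_mulVec, sub_eq_zero] at h0
  have h1 := (herm_isHerm M).im_star_dotProduct_mulVec_self v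
  rw [← h0, dotProduct_smul] at h1
  have h2 : star v ⬝ᵥ v = ((∑ i, Complex.normSq (v i) : ℝ) : ℂ) := by
    simp [dotProduct, Complex.normSq_eq_conj_mul_self]
  rw [h2] at h1
  simp only [smul_eq_mul, RCLike.im_to_complex, Complex.im_mul_ofReal, mul_eq_zero, hx, false_or] at h1
  rw [Finset.sum_eq_zero_iff_of_nonneg (fun i _ => Complex.normSq_nonneg _)] at h1
  apply hv
  ext i
  simpa using h1 i (Finset.mem_univ i)

lemma res_bound (M : HermMat N) {x : ℂ} (hx : x.im ≠ 0) (i j : Fin N) :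
    ‖(x • (1 : Matrix (Fin N) (Fin N) ℂ) - M.1)⁻¹ i j‖ ≤ |x.im|⁻¹ := by
  set R := x • (1 : Matrix (Fin N) (Fin N) ℂ) - M.1 with hR
  have hu : IsUnit R.det := res_isUnit M hx
  set A := R⁻¹ with hA
  have hRA : R * A = 1 := Matrix.mul_nonsing_inv _ hu
  have hAR : A * R = 1 := Matrix.nonsing_inv_mul _ hu
  have hRs : Rᴴ = (starRingEnd ℂ x) • (1 : Matrix (Fin N) (Fin N) ℂ) - M.1 := by
    rw [hR, conjTranspose_sub, conjTranspose_smul, conjTranspose_one, (herm_isHerm M).eq]; rfl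
  have hRsA : Rᴴ * Aᴴ = 1 := by rw [← conjTranspose_mul, hAR, conjTranspose_one]
  have key : A - Aᴴ = (starRingEnd ℂ x - x) • (A * Aᴴ) := by
    have : A * (Rᴴ - R) * Aᴴ = A - Aᴴ := by
      rw [mul_sub, sub_mul, hAR, one_mul, mul_assoc, hRsA, mul_one]
    rw [← this, hRs, hR]
    have e : (starRingEnd ℂ x • (1 : Matrix (Fin N) (Fin N) ℂ) - M.1 - (x • 1 - M.1))
      = (starRingEnd ℂ x - x) • 1 := by rw [sub_smul]; abel
    rw [e]; simp
  have hii : (A i i).im = - x.im * ∑ k, Complex.normSq (A i k) := by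
    have h := congrFun (congrFun key i) i
    have h2 : (A * Aᴴ) i i = ((∑ k, Complex.normSq (A i k) : ℝ) : ℂ) := by
      simp [Matrix.mul_apply, Complex.mul_conj]
    rw [Matrix.smul_apply, h2, Matrix.sub_apply, Matrix.conjTranspose_apply] at h
    have h3 := congrArg Complex.im h
    rw [smul_eq_mul, Complex.im_mul_ofReal] at h3
    simp at h3
    linarith
  set s := ∑ k, Complex.normSq (A i k) with hs
  have hk : ∀ k, ‖A i k‖ ^ 2 ≤ s := by
    intro k
    rw [← Complex.normSq_eq_norm_sq]
    exact Finset.single_le_sum (f := fun k => Complex.normSq (A i k)) (fun k _ => Complex.normSq_nonneg _) (Finset.mem_univ k)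
  have hs0 : 0 ≤ s := Finset.sum_nonneg (fun k _ => Complex.normSq_nonneg _)
  have ha : 0 < |x.im| := abs_pos.mpr hx
  have h1 : |x.im| * s ≤ ‖A i i‖ := by
    calc |x.im| * s = |(A i i).im| := by rw [hii, abs_mul, abs_neg, abs_of_nonneg hs0]
      _ ≤ _ := Complex.abs_im_le_norm _
  have h2 := hk i
  have h3 := hk j
  have n0 := norm_nonneg (A i i)
  have h4 : |x.im| * ‖A i i‖ ≤ 1 := by
    by_contra hc
    push Not at hc
    have : 0 < ‖A i i‖ := by
      by_contra h; have : ‖A i i‖ = 0 := le_antisymm (not_lt.mp h) n0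
      rw [this] at hc; simp at hc; linarith
    nlinarith
  rw [← one_div, le_div_iff₀ ha]
  have : (‖A i j‖ * |x.im|) ^ 2 ≤ 1 := by
    have : ‖A i j‖ ^ 2 * |x.im| ^ 2 ≤ 1 := by
      calc ‖A i j‖ ^ 2 * |x.im| ^ 2 ≤ s * |x.im| ^ 2 := by gcongr
        _ = |x.im| * (|x.im| * s) := by ring
        _ ≤ |x.im| * ‖A i i‖ := by gcongr
        _ ≤ 1 := h4
    linarith [mul_pow ‖A i j‖ |x.im| 2]
  exact (sq_le_one_iff₀ (by positivity)).mp this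

open Unitary in
/-- spectral form -/
lemma herm_spec (M : HermMat N) : ∃ (a : Fin N → ℝ) (U : Matrix (Fin N) (Fin N) ℂ),
    U * star U = 1 ∧ star U * U = 1 ∧ ∀ V : Polynomial ℝ, Polynomial.aeval M.1 V =
      U * diagonal (fun i => ((V.eval (a i) : ℝ) : ℂ)) * star U := by
  refine ⟨(herm_isHerm M).eigenvalues, (herm_isHerm M).eigenvectorUnitary, by simp, by simp, ?_⟩
  intro V
  have h := (herm_isHerm M).spectral_theorem
  have key : ∀ D : Matrix (Fin N) (Fin N) ℂ, conjStarAlgAut ℂ _ (herm_isHerm M).eigenvectorUnitary D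
    = ((herm_isHerm M).eigenvectorUnitary : Matrix (Fin N) (Fin N) ℂ) * D * star ((herm_isHerm M).eigenvectorUnitary : Matrix (Fin N) (Fin N) ℂ) := by
    intro D; rw [conjStarAlgAut_apply]
  rw [← key]
  conv_lhs => rw [h]
  set φ := conjStarAlgAut ℂ (Matrix (Fin N) (Fin N) ℂ) (herm_isHerm M).eigenvectorUnitary
  have h2 := Polynomial.map_aeval_eq_aeval_map (φ := RingHom.id ℝ) (ψ := (φ : Matrix (Fin N) (Fin N) ℂ →+* Matrix (Fin N) (Fin N) ℂ)) (by
    ext1 r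
    simp only [RingHom.comp_apply, RingHom.id_apply, Algebra.algebraMap_eq_smul_one]
    have e : (r • (1 : Matrix (Fin N) (Fin N) ℂ)) = (r : ℂ) • 1 := (Complex.coe_smul r _).symm
    rw [e]
    change _ = φ ((r : ℂ) • 1)
    rw [map_smul, map_one]) V (diagonal (RCLike.ofReal ∘ (herm_isHerm M).eigenvalues))
  rw [Polynomial.map_id] at h2
  refine h2.symm.trans ?_
  change φ _ = φ _
  congr 1
  have h3 := Polynomial.aeval_algHom_apply (Matrix.diagonalAlgHom ℝ : (Fin N → ℂ) →ₐ[ℝ] _) (RCLike.ofReal ∘ (herm_isHerm M).eigenvalues) V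
  simp only [Matrix.diagonalAlgHom_apply] at h3
  rw [h3]
  congr 1
  ext i
  have h4 := Polynomial.aeval_algHom_apply (Pi.evalAlgHom ℝ (fun _ : Fin N => ℂ) i) (RCLike.ofReal ∘ (herm_isHerm M).eigenvalues) V
  simp only [Pi.evalAlgHom_apply] at h4
  rw [← h4]
  simp only [Function.comp]
  exact Polynomial.aeval_algebraMap_apply ℂ ((herm_isHerm M).eigenvalues i) V
 
lemma trace_spec_prod (U W : Matrix (Fin N) (Fin N) ℂ) (a b : Fin N → ℝ) :
    (U * diagonal (fun i => (a i : ℂ)) * star U * (W * diagonal (fun i => (b i : ℂ)) * star W)).trace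
      = ((∑ i, ∑ j, a i * b j * Complex.normSq ((star U * W) i j) : ℝ) : ℂ) := by
  have : (U * diagonal (fun i => (a i : ℂ)) * star U * (W * diagonal (fun i => (b i : ℂ)) * star W)).trace
     = (diagonal (fun i => (a i : ℂ)) * (star U * W) * diagonal (fun i => (b i : ℂ)) * star (star U * W)).trace := by
    rw [star_mul, star_star]
    simp only [mul_assoc]
    rw [Matrix.trace_mul_comm U]
    simp only [mul_assoc]
  rw [this]
  set Q := star U * W
  rw [Matrix.trace]
  simp only [Matrix.diag_apply]
  push_cast
  refine Finset.sum_congr rfl fun i _ => ?_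
  rw [Matrix.mul_apply]
  refine Finset.sum_congr rfl fun j _ => ?_
  rw [Matrix.mul_diagonal, Matrix.diagonal_mul, Matrix.star_apply, ← Complex.mul_conj]
  simp only [RCLike.star_def]
  ring

/-- the action as a real number -/
lemma action_bound (V₁ V₂ : Polynomial ℝ) {c C : ℝ}
    (h : ∀ x y : ℝ, c * (x ^ 2 + y ^ 2) - C ≤ V₁.eval x + V₂.eval y - x * y)
    (M₁ M₂ : HermMat N) : ∃ r : ℝ,
    (Polynomial.aeval M₁.1 V₁ + Polynomial.aeval M₂.1 V₂ - M₁.1 * M₂.1).trace = (r : ℂ) ∧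
    ∃ s : ℝ, (M₁.1 * M₁.1 + M₂.1 * M₂.1).trace = (s : ℂ) ∧ c * s - C * N ≤ r := by
  obtain ⟨a, U, hU, hU', ha⟩ := herm_spec M₁
  obtain ⟨b, W, hW, hW', hb⟩ := herm_spec M₂
  set q : Fin N → Fin N → ℝ := fun i j => Complex.normSq ((star U * W) i j) with hq
  have hq0 : ∀ i j, 0 ≤ q i j := fun i j => Complex.normSq_nonneg _
  have t1 : ∀ V : Polynomial ℝ, (Polynomial.aeval M₁.1 V).trace = ((∑ i, ∑ j, V.eval (a i) * q i j : ℝ) : ℂ) := by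
    intro V
    have := trace_spec_prod U W (fun i => V.eval (a i)) (fun _ => 1)
    simp only [Complex.ofReal_one, Matrix.diagonal_one, mul_one, hW] at this
    rw [ha V, this]
  have t2 : ∀ V : Polynomial ℝ, (Polynomial.aeval M₂.1 V).trace = ((∑ i, ∑ j, V.eval (b j) * q i j : ℝ) : ℂ) := by
    intro V
    have := trace_spec_prod U W (fun _ => 1) (fun i => V.eval (b i)) 
    simp only [Complex.ofReal_one, Matrix.diagonal_one, mul_one, one_mul, hU] at this
    rw [hb V, this]
  have t3 : (M₁.1 * M₂.1).trace = ((∑ i, ∑ j, a i * b j * q i j : ℝ) : ℂ) := by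
    have h1 := ha Polynomial.X
    have h2 := hb Polynomial.X
    simp only [Polynomial.aeval_X, Polynomial.eval_X] at h1 h2
    rw [h1, h2, trace_spec_prod]
  have t4 : ((N : ℝ) : ℂ) = ((∑ i, ∑ j, q i j : ℝ) : ℂ) := by
    have := t1 1
    simpa using this
  have t4' : (N : ℝ) = ∑ i, ∑ j, q i j := by exact_mod_cast t4
  have t5 := t1 (Polynomial.X ^ 2)
  have t6 := t2 (Polynomial.X ^ 2)
  simp only [map_pow, Polynomial.aeval_X, Polynomial.eval_pow, Polynomial.eval_X] at t5 t6
  refine ⟨(∑ i, ∑ j, V₁.eval (a i) * q i j) + (∑ i, ∑ j, V₂.eval (b j) * q i j)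
      - (∑ i, ∑ j, a i * b j * q i j), ?_,
    (∑ i, ∑ j, a i ^ 2 * q i j) + (∑ i, ∑ j, b j ^ 2 * q i j), ?_, ?_⟩
  rotate_left
  · rw [← pow_two, ← pow_two, Matrix.trace_add, t5, t6, ← Complex.ofReal_add]
  rotate_left
  · rw [Matrix.trace_sub, Matrix.trace_add, t1, t2, t3, ← Complex.ofReal_add, ← Complex.ofReal_sub]
  rw [t4']
  simp only [Finset.mul_sum, ← Finset.sum_add_distrib, ← Finset.sum_sub_distrib]
  refine Finset.sum_le_sum fun i _ => Finset.sum_le_sum fun j _ => ?_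
  have := mul_le_mul_of_nonneg_right (h (a i) (b j)) (hq0 i j)
  linarith

lemma trace_sq_ge (M : HermMat N) : ∃ s : ℝ, (M.1 * M.1).trace = (s : ℂ) ∧ ‖M‖ ^ 2 ≤ s := by
  refine ⟨∑ i, ∑ j, Complex.normSq (M.1 i j), ?_, ?_⟩
  · simp only [Matrix.trace, Matrix.diag_apply, Matrix.mul_apply]
    push_cast
    refine Finset.sum_congr rfl fun i _ => Finset.sum_congr rfl fun j _ => ?_
    rw [← Complex.mul_conj, ← (herm_isHerm M).apply j i]; rfl
  · set s := ∑ i, ∑ j, Complex.normSq (M.1 i j)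
    have hs : 0 ≤ s := Finset.sum_nonneg fun i _ => Finset.sum_nonneg fun j _ => Complex.normSq_nonneg _
    have : ‖M‖ ≤ √s := by
      rw [herm_norm_le_iff _ (Real.sqrt_nonneg _)]
      intro i j
      apply Real.le_sqrt_of_sq_le
      rw [← Complex.normSq_eq_norm_sq]
      calc _ ≤ ∑ j, Complex.normSq (M.1 i j) := Finset.single_le_sum (f := fun j => Complex.normSq (M.1 i j)) (fun k _ => Complex.normSq_nonneg _) (Finset.mem_univ j)
        _ ≤ s := Finset.single_le_sum (f := fun i => ∑ j, Complex.normSq (M.1 i j)) (fun k _ => Finset.sum_nonneg fun j _ => Complex.normSq_nonneg _) (Finset.mem_univ i)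
    calc ‖M‖ ^ 2 ≤ (√s) ^ 2 := by gcongr
      _ = s := Real.sq_sqrt hs

end linalg


abbrev Om (N : ℕ) : Type := HermMat N × HermMat N

structure Good {N : ℕ} (f : Om N → ℂ) : Prop where
  cont : Continuous f
  bound : ∃ (C : ℝ) (k : ℕ), 0 ≤ C ∧ ∀ p, ‖f p‖ ≤ C * (1 + ‖p‖) ^ k

namespace Good
variable {N : ℕ} {f g : Om N → ℂ}

lemma const (c : ℂ) : Good (fun _ : Om N => c) :=
  ⟨continuous_const, ‖c‖, 0, norm_nonneg _, fun p => by simp⟩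

lemma add (hf : Good f) (hg : Good g) : Good (fun p => f p + g p) := by
  obtain ⟨cf, C, k, hC, h1⟩ := hf
  obtain ⟨cg, D, l, hD, h2⟩ := hg
  refine ⟨cf.add cg, C + D, k + l, by positivity, fun p => ?_⟩
  have h : (1 : ℝ) ≤ 1 + ‖p‖ := by linarith [norm_nonneg p]
  calc ‖f p + g p‖ ≤ ‖f p‖ + ‖g p‖ := norm_add_le _ _
    _ ≤ C * (1 + ‖p‖) ^ k + D * (1 + ‖p‖) ^ l := add_le_add (h1 p) (h2 p)
    _ ≤ C * (1 + ‖p‖) ^ (k + l) + D * (1 + ‖p‖) ^ (k + l) := by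
        have i1 : (1 + ‖p‖) ^ k ≤ (1 + ‖p‖) ^ (k + l) := pow_le_pow_right₀ h (by omega)
        have i2 : (1 + ‖p‖) ^ l ≤ (1 + ‖p‖) ^ (k + l) := pow_le_pow_right₀ h (by omega)
        gcongr
    _ = _ := by ring

lemma mul (hf : Good f) (hg : Good g) : Good (fun p => f p * g p) := by
  obtain ⟨cf, C, k, hC, h1⟩ := hf
  obtain ⟨cg, D, l, hD, h2⟩ := hg
  refine ⟨cf.mul cg, C * D, k + l, by positivity, fun p => ?_⟩
  rw [norm_mul]
  calc ‖f p‖ * ‖g p‖ ≤ (C * (1 + ‖p‖) ^ k) * (D * (1 + ‖p‖) ^ l) :=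
        mul_le_mul (h1 p) (h2 p) (norm_nonneg _) (by positivity)
    _ = _ := by ring

lemma neg (hf : Good f) : Good (fun p => - f p) := by
  simpa using (const (-1)).mul hf

lemma sub (hf : Good f) (hg : Good g) : Good (fun p => f p - g p) := by
  simpa [sub_eq_add_neg] using hf.add hg.neg

lemma sum {ι : Type*} (s : Finset ι) {F : ι → Om N → ℂ} (h : ∀ i ∈ s, Good (F i)) :
    Good (fun p => ∑ i ∈ s, F i p) := by
  classical
  induction s using Finset.induction_on with
  | empty => simpa using const 0
  | insert a s ha ih =>
    simp only [Finset.sum_insert ha]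
    exact (h a (by simp)).add (ih fun i hi => h i (by simp [hi]))

end Good

def MGood {N : ℕ} (F : Om N → Matrix (Fin N) (Fin N) ℂ) : Prop := ∀ i j, Good (fun p => F p i j)

namespace MGood
variable {N : ℕ} {F G : Om N → Matrix (Fin N) (Fin N) ℂ}

lemma const (c : Matrix (Fin N) (Fin N) ℂ) : MGood (fun _ : Om N => c) := fun _ _ => Good.const _

lemma add (hF : MGood F) (hG : MGood G) : MGood (fun p => F p + G p) := fun i j =>
  (hF i j).add (hG i j)

lemma sub (hF : MGood F) (hG : MGood G) : MGood (fun p => F p - G p) := fun i j =>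
  (hF i j).sub (hG i j)

lemma smul (c : ℂ) (hF : MGood F) : MGood (fun p => c • F p) := fun i j =>
  (Good.const c).mul (hF i j)

lemma mul (hF : MGood F) (hG : MGood G) : MGood (fun p => F p * G p) := fun i j => by
  simp only [Matrix.mul_apply]
  exact Good.sum _ fun k _ => (hF i k).mul (hG k j)

lemma pow (hF : MGood F) (n : ℕ) : MGood (fun p => F p ^ n) := by
  induction n with
  | zero => simpa using const 1
  | succ n ih => simpa only [pow_succ] using ih.mul hF

lemma sum {ι : Type*} (s : Finset ι) {F : ι → Om N → Matrix (Fin N) (Fin N) ℂ}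
    (h : ∀ i ∈ s, MGood (F i)) : MGood (fun p => ∑ i ∈ s, F i p) := fun i j => by
  simp only [Matrix.sum_apply]
  exact Good.sum _ fun k hk => h k hk i j

lemma trace (hF : MGood F) : Good (fun p => (F p).trace) :=
  Good.sum _ fun i _ => hF i i

lemma aeval (hF : MGood F) (V : Polynomial ℝ) : MGood (fun p => Polynomial.aeval (F p) V) := by
  simp only [Polynomial.aeval_eq_sum_range]
  refine sum _ fun k _ => ?_
  simpa only [Complex.coe_smul] using (hF.pow k).smul ((V.coeff k : ℝ) : ℂ)

lemma fst : MGood (fun p : Om N => p.1.1) := fun i j => by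
  refine ⟨?_, 1, 1, zero_le_one, fun p => ?_⟩
  · exact (continuous_subtype_val.comp continuous_fst).matrix_elem i j
  · have h1 := (herm_norm_le_iff p.1 (norm_nonneg _)).mp le_rfl i j
    have h2 := norm_fst_le p
    simp only [one_mul, pow_one]; linarith

lemma snd : MGood (fun p : Om N => p.2.1) := fun i j => by
  refine ⟨?_, 1, 1, zero_le_one, fun p => ?_⟩
  · exact (continuous_subtype_val.comp continuous_snd).matrix_elem i j
  · have h1 := (herm_norm_le_iff p.2 (norm_nonneg _)).mp le_rfl i j
    have h2 := norm_snd_le p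
    simp only [one_mul, pow_one]; linarith

lemma SV (hF : MGood F) (V : Polynomial ℝ) (z : ℂ) : MGood (fun p => SVmat V z (F p)) := by
  unfold SVmat
  exact sum _ fun k _ => smul _ (sum _ fun l _ => smul _ (hF.pow _))

end MGood

noncomputable abbrev Res {N : ℕ} (x : ℂ) (M : Matrix (Fin N) (Fin N) ℂ) :
    Matrix (Fin N) (Fin N) ℂ := (x • (1 : Matrix (Fin N) (Fin N) ℂ) - M)⁻¹

section
variable {N : ℕ}

lemma res_cont {x : ℂ} (hx : x.im ≠ 0) (i j : Fin N) :
    Continuous (fun M : HermMat N => Res x M.1 i j) := by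
  have hc : Continuous (fun M : HermMat N => x • (1 : Matrix (Fin N) (Fin N) ℂ) - M.1) :=
    continuous_const.sub continuous_subtype_val
  have : (fun M : HermMat N => Res x M.1 i j) = fun M : HermMat N =>
      ((x • (1 : Matrix (Fin N) (Fin N) ℂ) - M.1).det)⁻¹ *
        (x • (1 : Matrix (Fin N) (Fin N) ℂ) - M.1).adjugate i j := by
    ext M
    rw [Res, Matrix.inv_def, Ring.inverse_eq_inv]; rfl
  rw [this]
  exact (hc.matrix_det.inv₀ fun M => (res_isUnit M hx).ne_zero).mul (hc.matrix_adjugate.matrix_elem i j)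

lemma res_good1 {x : ℂ} (hx : x.im ≠ 0) : MGood (fun p : Om N => Res x p.1.1) := fun i j =>
  ⟨(res_cont hx i j).comp continuous_fst, |x.im|⁻¹, 0, by positivity, fun p => by
    simpa using res_bound p.1 hx i j⟩

lemma res_good2 {x : ℂ} (hx : x.im ≠ 0) : MGood (fun p : Om N => Res x p.2.1) := fun i j =>
  ⟨(res_cont hx i j).comp continuous_snd, |x.im|⁻¹, 0, by positivity, fun p => by
    simpa using res_bound p.2 hx i j⟩

/-- entrywise derivative at zero -/
def MD (F : ℝ → Matrix (Fin N) (Fin N) ℂ) (F' : Matrix (Fin N) (Fin N) ℂ) : Prop :=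
  ∀ i j, HasDerivAt (fun t => F t i j) (F' i j) 0

namespace MD
variable {F G : ℝ → Matrix (Fin N) (Fin N) ℂ} {F' G' : Matrix (Fin N) (Fin N) ℂ}

lemma const (c : Matrix (Fin N) (Fin N) ℂ) : MD (fun _ => c) 0 := fun _ _ => hasDerivAt_const _ _

lemma add (hF : MD F F') (hG : MD G G') : MD (fun t => F t + G t) (F' + G') := fun i j =>
  (hF i j).add (hG i j)

lemma sub (hF : MD F F') (hG : MD G G') : MD (fun t => F t - G t) (F' - G') := fun i j =>
  (hF i j).sub (hG i j)

lemma mul (hF : MD F F') (hG : MD G G') : MD (fun t => F t * G t) (F' * G 0 + F 0 * G') := by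
  intro i j
  simp only [Matrix.mul_apply, Matrix.add_apply]
  rw [← Finset.sum_add_distrib]
  exact HasDerivAt.fun_sum fun k _ => (hF i k).mul (hG k j)

lemma smul (c : ℝ) (hF : MD F F') : MD (fun t => c • F t) (c • F') := fun i j =>
  (hF i j).const_smul c

lemma trace (hF : MD F F') : HasDerivAt (fun t => (F t).trace) F'.trace 0 :=
  HasDerivAt.fun_sum fun i _ => hF i i

lemma line (M H : HermMat N) : MD (fun t : ℝ => (M + t • H).1) H.1 := by
  intro i j
  have : (fun t : ℝ => (M + t • H).1 i j) = fun t : ℝ => M.1 i j + t • H.1 i j := rfl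
  rw [this]
  simpa using ((hasDerivAt_id (0 : ℝ)).smul_const (H.1 i j)).const_add (M.1 i j)

lemma poly (hF : MD F F') (V : Polynomial ℝ) : ∃ D, MD (fun t => Polynomial.aeval (F t) V) D ∧
    ∀ R, Commute (F 0) R →
      (D * R).trace = (Polynomial.aeval (F 0) V.derivative * F' * R).trace := by
  induction V using Polynomial.induction_on with
  | C a => exact ⟨0, by simpa using const _, by simp⟩
  | add p q hp hq =>
    obtain ⟨D, hD, h1⟩ := hp
    obtain ⟨E, hE, h2⟩ := hq
    refine ⟨D + E, by simpa using hD.add hE, fun R hR => ?_⟩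
    simp [add_mul, h1 R hR, h2 R hR]
  | monomial n a ih =>
    obtain ⟨D, hD, h1⟩ := ih
    have e : Polynomial.C a * Polynomial.X ^ (n + 1) =
        Polynomial.C a * Polynomial.X ^ n * Polynomial.X := by ring
    rw [e]
    generalize Polynomial.C a * Polynomial.X ^ n = p at *
    refine ⟨D * F 0 + Polynomial.aeval (F 0) p * F', ?_, fun R hR => ?_⟩
    · simpa only [map_mul, Polynomial.aeval_X] using hD.mul hF
    · have h2 := h1 (F 0 * R) ((Commute.refl _).mul_right hR)
      have h3 : Commute (F 0) (Polynomial.aeval (F 0) p.derivative) := by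
        have := Polynomial.aeval_X (R := ℝ) (F 0)
        rw [← this]
        conv_rhs => rw [this]
        exact (Commute.all Polynomial.X p.derivative).map (Polynomial.aeval (F 0))
      rw [add_mul, Matrix.trace_add, mul_assoc, h2, Polynomial.derivative_mul,
        Polynomial.derivative_X, mul_one, map_add, map_mul, Polynomial.aeval_X, add_mul, add_mul,
        Matrix.trace_add, hR.eq, ← h3.eq]
      congr 1
      rw [← mul_assoc, Matrix.trace_mul_comm]
      simp only [mul_assoc]

lemma resolvent (M H : HermMat N) {x : ℂ} (hx : x.im ≠ 0) :
    MD (fun t : ℝ => Res x (M + t • H).1) (Res x M.1 * H.1 * Res x M.1) := by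
  intro i j
  have hid : ∀ t : ℝ, Res x (M + t • H).1 =
      Res x M.1 + t • (Res x (M + t • H).1 * H.1 * Res x M.1) := by
    intro t
    have u1 := res_isUnit (M + t • H) hx
    have u2 := res_isUnit M hx
    have e : Res x (M + t • H).1 - Res x M.1 = Res x (M + t • H).1 *
      ((x • (1 : Matrix (Fin N) (Fin N) ℂ) - M.1) -
        (x • (1 : Matrix (Fin N) (Fin N) ℂ) - (M + t • H).1)) * Res x M.1 := by
      rw [mul_sub, sub_mul, Res, Res, mul_assoc, Matrix.mul_nonsing_inv _ u2,
        Matrix.nonsing_inv_mul _ u1, one_mul, mul_one]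
    have e2 : (x • (1 : Matrix (Fin N) (Fin N) ℂ) - M.1) -
        (x • (1 : Matrix (Fin N) (Fin N) ℂ) - (M + t • H).1) = t • H.1 := by
      have : (M + t • H).1 = M.1 + t • H.1 := rfl
      rw [this]; abel
    rw [e2] at e
    rw [sub_eq_iff_eq_add'] at e
    conv_lhs => rw [e]
    simp
  set g : ℝ → ℂ := fun t => (Res x (M + t • H).1 * H.1 * Res x M.1) i j with hg
  have hgc : Continuous g := by
    simp only [hg, Matrix.mul_apply]
    refine continuous_finsetSum _ fun k _ => Continuous.mul ?_ continuous_const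
    refine continuous_finsetSum _ fun l _ => Continuous.mul ?_ continuous_const
    exact (res_cont hx i l).comp (by fun_prop : Continuous fun t : ℝ => M + t • H)
  have hg0 : (Res x M.1 * H.1 * Res x M.1) i j = g 0 := by simp [hg]
  rw [hg0]
  have hfun : (fun t : ℝ => Res x (M + t • H).1 i j) = fun t => Res x M.1 i j + t • g t := by
    ext t
    conv_lhs => rw [hid t]
    rfl
  rw [hfun]
  refine HasDerivAt.const_add _ ?_
  rw [hasDerivAt_iff_tendsto_slope_zero]
  refine (hgc.tendsto 0 |>.mono_left nhdsWithin_le_nhds).congr' ?_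
  filter_upwards [self_mem_nhdsWithin] with t ht
  have ht : t ≠ 0 := ht
  simp [ht]

end MD

/-- weight as function on pairs -/
noncomputable abbrev wt (N : ℕ) (T : ℝ) (V₁ V₂ : Polynomial ℝ) (p : Om N) : ℂ :=
  hweight N T V₁ V₂ p.1.1 p.2.1

lemma wt_deriv (T : ℝ) (V₁ V₂ : Polynomial ℝ) (p v : Om N) :
    HasLineDerivAt ℝ (wt N T V₁ V₂)
      (-((N : ℂ) / (T : ℂ)) * (((Polynomial.aeval p.1.1 V₁.derivative - p.2.1) * v.1.1).trace +
        ((Polynomial.aeval p.2.1 V₂.derivative - p.1.1) * v.2.1).trace) * wt N T V₁ V₂ p) p v := by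
  unfold HasLineDerivAt
  have d1 := MD.line p.1 v.1
  have d2 := MD.line p.2 v.2
  obtain ⟨D₁, hD₁, e₁⟩ := d1.poly V₁
  obtain ⟨D₂, hD₂, e₂⟩ := d2.poly V₂
  have h := ((hD₁.add hD₂).sub (d1.mul d2)).trace
  have h2 := (h.const_mul (-((N : ℂ) / (T : ℂ)))).cexp
  have e₁ := e₁ 1 (Commute.one_right _)
  have e₂ := e₂ 1 (Commute.one_right _)
  simp only [mul_one, zero_smul, add_zero] at e₁ e₂
  refine HasDerivAt.congr_deriv h2 ?_
  simp only [zero_smul, add_zero, Matrix.trace_sub, Matrix.trace_add, e₁, e₂, sub_mul, hweight]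
  rw [Matrix.trace_mul_comm v.1.1]
  ring

lemma wt_cont (T : ℝ) (V₁ V₂ : Polynomial ℝ) : Continuous (wt N T V₁ V₂) := by
  have h : Good (fun p : Om N => (Polynomial.aeval p.1.1 V₁ + Polynomial.aeval p.2.1 V₂ - p.1.1 * p.2.1).trace) :=
    (((MGood.fst.aeval V₁).add (MGood.snd.aeval V₂)).sub (MGood.fst.mul MGood.snd)).trace
  exact (continuous_const.mul h.cont).cexp

def Conf (V₁ V₂ : Polynomial ℝ) : Prop := ∃ c > (0 : ℝ), ∃ C : ℝ, ∀ x y : ℝ,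
      c * (x ^ 2 + y ^ 2) - C ≤ V₁.eval x + V₂.eval y - x * y

lemma wt_real (T : ℝ) {V₁ V₂ : Polynomial ℝ} (h : Conf V₁ V₂) (p : Om N) :
    ∃ r : ℝ, 0 < r ∧ wt N T V₁ V₂ p = r := by
  obtain ⟨c, hc, C, h⟩ := h
  obtain ⟨r, hr, -⟩ := action_bound V₁ V₂ h p.1 p.2
  refine ⟨Real.exp (-(N / T) * r), Real.exp_pos _, ?_⟩
  rw [wt, hweight, hr]
  push_cast
  rfl

lemma wt_bound (hN : 1 ≤ N) {T : ℝ} (hT : 0 < T) {V₁ V₂ : Polynomial ℝ} (h : Conf V₁ V₂) :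
    ∃ K b : ℝ, 0 < K ∧ 0 < b ∧ ∀ p : Om N, ‖wt N T V₁ V₂ p‖ ≤ K * Real.exp (-b * ‖p‖ ^ 2) := by
  obtain ⟨c, hc, C, h⟩ := h
  have hN' : (0 : ℝ) < N := by exact_mod_cast hN
  refine ⟨Real.exp (N / T * (C * N)), N / T * c, Real.exp_pos _, by positivity, fun p => ?_⟩
  obtain ⟨r, hr, s, hs, hle⟩ := action_bound V₁ V₂ h p.1 p.2
  obtain ⟨s₁, hs₁, h₁⟩ := trace_sq_ge p.1
  obtain ⟨s₂, hs₂, h₂⟩ := trace_sq_ge p.2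
  have hs' : s = s₁ + s₂ := by
    rw [Matrix.trace_add, hs₁, hs₂] at hs
    exact_mod_cast hs.symm
  have hp : ‖p‖ ^ 2 ≤ s := by
    rw [hs', Prod.norm_def]
    rcases max_cases ‖p.1‖ ‖p.2‖ with ⟨e, -⟩ | ⟨e, -⟩ <;> rw [e] <;> nlinarith [sq_nonneg ‖p.1‖, sq_nonneg ‖p.2‖]
  have hw : wt N T V₁ V₂ p = (Real.exp (-(N / T) * r) : ℝ) := by
    rw [wt, hweight, hr]; push_cast; rfl
  rw [hw, Complex.norm_real, Real.norm_of_nonneg (Real.exp_pos _).le, ← Real.exp_add]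
  apply Real.exp_le_exp.mpr
  have hk : 0 < (N : ℝ) / T := by positivity
  have : c * ‖p‖ ^ 2 - C * N ≤ r := by nlinarith
  nlinarith

lemma poly_exp_bound {b : ℝ} (hb : 0 < b) (m : ℕ) {r : ℝ} (hr : 0 ≤ r) :
    (1 + r) ^ m * Real.exp (-b * r ^ 2) ≤ m.factorial * Real.exp (1 + 1 / (4 * b)) := by
  have h1 : (1 + r) ^ m ≤ m.factorial * Real.exp (1 + r) := by
    have := Real.pow_div_factorial_le_exp (1 + r) (by linarith) m
    rwa [div_le_iff₀' (by positivity)] at this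
  calc (1 + r) ^ m * Real.exp (-b * r ^ 2)
      ≤ (m.factorial * Real.exp (1 + r)) * Real.exp (-b * r ^ 2) := by gcongr
    _ = m.factorial * Real.exp (1 + r + -b * r ^ 2) := by rw [mul_assoc, ← Real.exp_add]
    _ ≤ _ := by
      refine mul_le_mul_of_nonneg_left (Real.exp_le_exp.mpr ?_) (by positivity)
      have : b * r ^ 2 - r + 1 / (4 * b) = b * (r - 1 / (2 * b)) ^ 2 := by field_simp; ring
      have : 0 ≤ b * r ^ 2 - r + 1 / (4 * b) := by rw [this]; positivity
      linarith

variable [MeasurableSpace (HermMat N)] [BorelSpace (HermMat N)]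
    (μ : Measure (HermMat N)) [μ.IsAddHaarMeasure]

lemma good_integrable (hN : 1 ≤ N) {T : ℝ} (hT : 0 < T) {V₁ V₂ : Polynomial ℝ} (h : Conf V₁ V₂)
    {f : Om N → ℂ} (hf : Good f) : Integrable (fun p => f p * wt N T V₁ V₂ p) (μ.prod μ) := by
  obtain ⟨K, b, hK, hb, hw⟩ := wt_bound hN hT h
  obtain ⟨C, k, hC, hfb⟩ := hf.bound
  set d := Module.finrank ℝ (Om N) with hd
  have hi : Integrable (fun p : Om N => (1 + ‖p‖) ^ (-((d + 1 : ℕ) : ℝ))) (μ.prod μ) :=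
    integrable_one_add_norm (by rw [← hd]; push_cast; linarith)
  refine (hi.const_mul (C * K * ((k + (d + 1)).factorial * Real.exp (1 + 1 / (4 * b))))).mono'
    ((hf.cont.mul (wt_cont T V₁ V₂)).aestronglyMeasurable) (Filter.Eventually.of_forall fun p => ?_)
  have hp : 0 < 1 + ‖p‖ := by positivity
  rw [norm_mul, Real.rpow_neg hp.le, Real.rpow_natCast, ← div_eq_mul_inv, le_div_iff₀ (by positivity)]
  have := poly_exp_bound hb (k + (d + 1)) (norm_nonneg p)
  calc ‖f p‖ * ‖wt N T V₁ V₂ p‖ * (1 + ‖p‖) ^ (d + 1)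
      ≤ (C * (1 + ‖p‖) ^ k) * (K * Real.exp (-b * ‖p‖ ^ 2)) * (1 + ‖p‖) ^ (d + 1) := by
        gcongr
        · exact hfb p
        · exact hw p
    _ = C * K * ((1 + ‖p‖) ^ (k + (d + 1)) * Real.exp (-b * ‖p‖ ^ 2)) := by rw [pow_add]; ring
    _ ≤ _ := by gcongr

/-- integration by parts -/
lemma ibp (hN : 1 ≤ N) {T : ℝ} (hT : 0 < T) {V₁ V₂ : Polynomial ℝ} (h : Conf V₁ V₂)
    {f f' g : Om N → ℂ} (v : Om N) (hf : Good f) (hf' : Good f') (hg : Good g)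
    (hfd : ∀ p, HasLineDerivAt ℝ f (f' p) p v)
    (hwd : ∀ p, HasLineDerivAt ℝ (wt N T V₁ V₂) (g p * wt N T V₁ V₂ p) p v) :
    ∫ p, (f' p + f p * g p) * wt N T V₁ V₂ p ∂(μ.prod μ) = 0 := by
  have i1 := good_integrable μ hN hT h hf
  have i2 := good_integrable μ hN hT h hf'
  have i3 := good_integrable μ hN hT h (hf.mul hg)
  have i3' : Integrable (fun p => f p * (g p * wt N T V₁ V₂ p)) (μ.prod μ) := by
    simpa only [mul_assoc] using i3
  have := integral_bilinear_hasLineDerivAt_right_eq_neg_left_of_integrable (μ := μ.prod μ)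
    (B := ContinuousLinearMap.mul ℝ ℂ) (v := v) (f := f) (f' := f') (g := wt N T V₁ V₂)
    (g' := fun p => g p * wt N T V₁ V₂ p) i2 i3' i1 (fun p _ => hfd p) (fun p _ => hwd p)
  simp only [ContinuousLinearMap.mul_apply'] at this
  simp only [add_mul]
  rw [integral_add i2 i3]
  simp only [mul_assoc]
  rw [this]; ring

lemma loop (hN : 1 ≤ N) {T : ℝ} (hT : 0 < T) {V₁ V₂ : Polynomial ℝ} (h : Conf V₁ V₂)
    {F G P Q : Om N → Matrix (Fin N) (Fin N) ℂ} (ι : HermMat N → Om N)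
    (hF : MGood F) (hG : MGood G) (hP : MGood P) (hQ : MGood Q)
    (hfd : ∀ (H : HermMat N) p i j,
      HasLineDerivAt ℝ (fun p => F p i j) ((P p * H.1 * Q p) i j) p (ι H))
    (hwd : ∀ (H : HermMat N) p, HasLineDerivAt ℝ (wt N T V₁ V₂)
      (-((N : ℂ) / (T : ℂ)) * (G p * H.1).trace * wt N T V₁ V₂ p) p (ι H)) :
    ∫ p, ((P p).trace * (Q p).trace - (N : ℂ) / (T : ℂ) * (G p * F p).trace) *
      wt N T V₁ V₂ p ∂(μ.prod μ) = 0 := by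
  set L : Matrix (Fin N) (Fin N) ℂ → Fin N → Fin N → Om N → ℂ := fun H i j p =>
    (P p * H * Q p) i j + F p i j * (-((N : ℂ) / (T : ℂ)) * (G p * H).trace) with hL
  have gL : ∀ H i j, Good (L H i j) := fun H i j =>
    ((hP.mul (MGood.const H)).mul hQ i j).add
      ((hF i j).mul ((Good.const _).mul (hG.mul (MGood.const H)).trace))
  have iL : ∀ H i j, Integrable (fun p => L H i j p * wt N T V₁ V₂ p) (μ.prod μ) := fun H i j =>
    good_integrable μ hN hT h (gL H i j)
  have s1 : ∀ (H : HermMat N) i j, ∫ p, L H.1 i j p * wt N T V₁ V₂ p ∂(μ.prod μ) = 0 := by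
    intro H i j
    exact ibp μ hN hT h (ι H) (hF i j) ((hP.mul (MGood.const H.1)).mul hQ i j)
      ((Good.const _).mul (hG.mul (MGood.const H.1)).trace) (fun p => hfd H p i j) (hwd H)
  have s2 : ∀ (H : Matrix (Fin N) (Fin N) ℂ) i j,
      ∫ p, L H i j p * wt N T V₁ V₂ p ∂(μ.prod μ) = 0 := by
    intro H i j
    have hH := realPart_add_I_smul_imaginaryPart H
    have e : ∀ p, L H i j p * wt N T V₁ V₂ p = L (realPart H).1 i j p * wt N T V₁ V₂ p
        + Complex.I * (L (imaginaryPart H).1 i j p * wt N T V₁ V₂ p) := by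
      intro p
      conv_lhs => rw [← hH]
      simp only [hL, mul_add, add_mul, Matrix.mul_smul, Matrix.smul_mul, Matrix.trace_add,
        Matrix.trace_smul, Matrix.add_apply, Matrix.smul_apply, smul_eq_mul]
      ring
    simp only [e]
    rw [integral_add (iL _ i j) ((iL _ i j).const_mul _), integral_const_mul, s1, s1]
    simp
  have e : ∀ p, ((P p).trace * (Q p).trace - (N : ℂ) / (T : ℂ) * (G p * F p).trace) *
      wt N T V₁ V₂ p = ∑ i, ∑ j, L (Matrix.single i j (1 : ℂ)) i j p * wt N T V₁ V₂ p := by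
    intro p
    simp only [← Finset.sum_mul]
    congr 1
    have a1 : ∀ i j, (P p * Matrix.single i j (1 : ℂ) * Q p) i j = P p i i * Q p j j := by
      intro i j
      rw [Matrix.mul_apply, Finset.sum_eq_single j]
      · rw [Matrix.mul_single_apply_same]; simp
      · intro k _ hk
        rw [Matrix.mul_single_apply_of_ne _ _ _ _ _ hk]; simp
      · simp
    have a2 : ∀ i j, (G p * Matrix.single i j (1 : ℂ)).trace = G p j i := by
      intro i j
      rw [Matrix.trace_mul_single]; simp
    simp only [hL, a1, a2, Finset.sum_add_distrib]
    rw [sub_eq_add_neg]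
    congr 1
    · simp only [Matrix.trace, Matrix.diag_apply, Finset.sum_mul_sum]
    · simp only [Matrix.trace, Matrix.diag_apply, Matrix.mul_apply]
      rw [Finset.sum_comm, ← neg_mul, Finset.mul_sum]
      refine Finset.sum_congr rfl fun i _ => ?_
      rw [Finset.mul_sum]
      refine Finset.sum_congr rfl fun j _ => ?_
      ring
  simp only [e]
  rw [integral_finsetSum _ fun i _ => integrable_finsetSum _ fun j _ => iL _ i j]
  refine Finset.sum_eq_zero fun i _ => ?_
  rw [integral_finsetSum _ fun j _ => iL _ i j]
  exact Finset.sum_eq_zero fun j _ => s2 _ i j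

lemma Z_ne_zero (hN : 1 ≤ N) {T : ℝ} (hT : 0 < T) {V₁ V₂ : Polynomial ℝ} (h : Conf V₁ V₂) :
    ∫ p, wt N T V₁ V₂ p ∂(μ.prod μ) ≠ 0 := by
  choose r hr hw using fun p : Om N => wt_real T h p
  have hi := good_integrable μ hN hT h (Good.const (N := N) 1)
  simp only [one_mul, hw] at hi ⊢
  rw [integral_complex_ofReal]
  have hi' : Integrable r (μ.prod μ) := by simpa using hi.re
  have : 0 < ∫ p, r p ∂(μ.prod μ) := by
    rw [integral_pos_iff_support_of_nonneg (fun p => (hr p).le) hi']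
    have : Function.support r = Set.univ := by ext p; simp [(hr p).ne']
    rw [this]
    exact isOpen_univ.measure_pos _ Set.univ_nonempty
  exact_mod_cast this.ne'

end


section
variable {N : ℕ}

lemma geom_mat (z : ℂ) (M : Matrix (Fin N) (Fin N) ℂ) (k : ℕ) :
    (∑ l ∈ Finset.range k, z ^ l • M ^ (k - 1 - l)) * (z • (1 : Matrix (Fin N) (Fin N) ℂ) - M) =
      (z ^ k) • (1 : Matrix (Fin N) (Fin N) ℂ) - M ^ k := by
  have hc : Commute (z • (1 : Matrix (Fin N) (Fin N) ℂ)) M := (Commute.one_left M).smul_left z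
  have := hc.geom_sum₂_mul k
  simpa [smul_pow] using this

lemma SV_mul (V : Polynomial ℝ) (z : ℂ) (M : Matrix (Fin N) (Fin N) ℂ) :
    SVmat V z M * (z • (1 : Matrix (Fin N) (Fin N) ℂ) - M) =
      (Polynomial.aeval z V.derivative) • (1 : Matrix (Fin N) (Fin N) ℂ) -
        Polynomial.aeval M V.derivative := by
  rw [SVmat, Finset.sum_mul, Polynomial.aeval_eq_sum_range, Polynomial.aeval_eq_sum_range,
    Finset.sum_smul, ← Finset.sum_sub_distrib]
  refine Finset.sum_congr rfl fun k _ => ?_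
  rw [Matrix.smul_mul, geom_mat, smul_sub, smul_smul, Complex.coe_smul, Complex.real_smul]

lemma SV_comm (V : Polynomial ℝ) (z : ℂ) (M : Matrix (Fin N) (Fin N) ℂ) :
    Commute (SVmat V z M) M := by
  unfold SVmat
  refine Commute.sum_left _ _ _ fun k _ => Commute.smul_left (Commute.sum_left _ _ _ fun l _ => ?_) _
  exact ((Commute.refl M).pow_left _).smul_left _

lemma SV_snd (V : Polynomial ℝ) (z : ℂ) (M : Matrix (Fin N) (Fin N) ℂ) :
    SVmat V z M * M = z • SVmat V z M - (Polynomial.aeval z V.derivative) • (1 : Matrix (Fin N) (Fin N) ℂ)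
       + Polynomial.aeval M V.derivative := by
  have := SV_mul V z M
  rw [mul_sub, Matrix.mul_smul, mul_one] at this
  rw [sub_add, ← this, sub_sub_cancel]

/-- `V'(M) R = V'(z) R - S` -/
lemma aeval_res (V : Polynomial ℝ) {z : ℂ} (hz : z.im ≠ 0) (M : HermMat N) :
    Polynomial.aeval M.1 V.derivative * Res z M.1 =
      (Polynomial.aeval z V.derivative) • Res z M.1 - SVmat V z M.1 := by
  have h := SV_mul V z M.1
  have u := res_isUnit M hz
  have h2 : Polynomial.aeval M.1 V.derivative =
      (Polynomial.aeval z V.derivative) • (1 : Matrix (Fin N) (Fin N) ℂ) -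
       SVmat V z M.1 * (z • (1 : Matrix (Fin N) (Fin N) ℂ) - M.1) := by rw [h, sub_sub_cancel]
  rw [h2, sub_mul, Matrix.smul_mul, one_mul, mul_assoc, Res, Matrix.mul_nonsing_inv _ u, mul_one]

lemma res_aeval (V : Polynomial ℝ) {z : ℂ} (hz : z.im ≠ 0) (M : HermMat N) :
    Res z M.1 * Polynomial.aeval M.1 V.derivative =
      (Polynomial.aeval z V.derivative) • Res z M.1 - SVmat V z M.1 := by
  have h := SV_mul V z M.1
  have u := res_isUnit M hz
  have hc : Commute (SVmat V z M.1) (z • (1 : Matrix (Fin N) (Fin N) ℂ) - M.1) :=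
    Commute.sub_right ((Commute.one_right _).smul_right z) (SV_comm V z M.1)
  rw [hc.eq] at h
  have h2 : Polynomial.aeval M.1 V.derivative =
      (Polynomial.aeval z V.derivative) • (1 : Matrix (Fin N) (Fin N) ℂ) -
       (z • (1 : Matrix (Fin N) (Fin N) ℂ) - M.1) * SVmat V z M.1 := by rw [h, sub_sub_cancel]
  rw [h2, mul_sub, Matrix.mul_smul, mul_one, ← mul_assoc, Res, Matrix.nonsing_inv_mul _ u, one_mul]

lemma mul_res {z : ℂ} (hz : z.im ≠ 0) (M : HermMat N) :
    M.1 * Res z M.1 = z • Res z M.1 - 1 := by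
  have u := res_isUnit M hz
  have : (z • (1 : Matrix (Fin N) (Fin N) ℂ) - M.1) * Res z M.1 = 1 := Matrix.mul_nonsing_inv _ u
  rw [sub_mul, Matrix.smul_mul, one_mul] at this
  rw [← this, sub_sub_cancel]

variable [MeasurableSpace (HermMat N)] (μ : Measure (HermMat N))

/-- Normalised expectation of a function on pairs. -/
noncomputable def Ex (T : ℝ) (V₁ V₂ : Polynomial ℝ) (f : Om N → ℂ) : ℂ :=
  (∫ p, wt N T V₁ V₂ p ∂(μ.prod μ))⁻¹ * ∫ p, f p * wt N T V₁ V₂ p ∂(μ.prod μ)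

variable [BorelSpace (HermMat N)] [μ.IsAddHaarMeasure]

variable {f g : Om N → ℂ}

lemma Ex_add (hN : 1 ≤ N) {T : ℝ} (hT : 0 < T) {V₁ V₂ : Polynomial ℝ} (h : Conf V₁ V₂)
    (hf : Good f) (hg : Good g) :
    Ex μ T V₁ V₂ (fun p => f p + g p) = Ex μ T V₁ V₂ f + Ex μ T V₁ V₂ g := by
  simp only [Ex, add_mul]
  rw [integral_add (good_integrable μ hN hT h hf) (good_integrable μ hN hT h hg), mul_add]

lemma Ex_sub (hN : 1 ≤ N) {T : ℝ} (hT : 0 < T) {V₁ V₂ : Polynomial ℝ} (h : Conf V₁ V₂)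
    (hf : Good f) (hg : Good g) :
    Ex μ T V₁ V₂ (fun p => f p - g p) = Ex μ T V₁ V₂ f - Ex μ T V₁ V₂ g := by
  simp only [Ex, sub_mul]
  rw [integral_sub (good_integrable μ hN hT h hf) (good_integrable μ hN hT h hg), mul_sub]

lemma Ex_mul (T : ℝ) (V₁ V₂ : Polynomial ℝ) (c : ℂ) (f : Om N → ℂ) :
    Ex μ T V₁ V₂ (fun p => c * f p) = c * Ex μ T V₁ V₂ f := by
  simp only [Ex, mul_assoc]
  rw [integral_const_mul]; ring

lemma Ex_const (hN : 1 ≤ N) {T : ℝ} (hT : 0 < T) {V₁ V₂ : Polynomial ℝ} (h : Conf V₁ V₂) (c : ℂ) :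
    Ex μ T V₁ V₂ (fun _ => c) = c := by
  simp only [Ex]
  rw [integral_const_mul, mul_left_comm, inv_mul_cancel₀ (Z_ne_zero μ hN hT h), mul_one]

lemma loop_Ex (hN : 1 ≤ N) {T : ℝ} (hT : 0 < T) {V₁ V₂ : Polynomial ℝ} (h : Conf V₁ V₂)
    {F G P Q : Om N → Matrix (Fin N) (Fin N) ℂ} (ι : HermMat N → Om N)
    (hF : MGood F) (hG : MGood G) (hP : MGood P) (hQ : MGood Q)
    (hfd : ∀ (H : HermMat N) p i j,
      HasLineDerivAt ℝ (fun p => F p i j) ((P p * H.1 * Q p) i j) p (ι H))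
    (hwd : ∀ (H : HermMat N) p, HasLineDerivAt ℝ (wt N T V₁ V₂)
      (-((N : ℂ) / (T : ℂ)) * (G p * H.1).trace * wt N T V₁ V₂ p) p (ι H)) :
    Ex μ T V₁ V₂ (fun p => (P p).trace * (Q p).trace) =
      (N : ℂ) / (T : ℂ) * Ex μ T V₁ V₂ (fun p => (G p * F p).trace) := by
  have := loop μ hN hT h ι hF hG hP hQ hfd hwd
  rw [← Ex_mul, ← sub_eq_zero, ← Ex_sub μ hN hT h (hP.trace.mul hQ.trace)
    ((Good.const _).mul (hG.mul hF).trace)]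
  rw [Ex, this, mul_zero]

lemma wd1 (T : ℝ) (V₁ V₂ : Polynomial ℝ) (H : HermMat N) (p : Om N) :
    HasLineDerivAt ℝ (wt N T V₁ V₂)
      (-((N : ℂ) / (T : ℂ)) * ((Polynomial.aeval p.1.1 V₁.derivative - p.2.1) * H.1).trace
        * wt N T V₁ V₂ p) p (H, 0) := by
  simpa using wt_deriv T V₁ V₂ p (H, 0)

lemma wd2 (T : ℝ) (V₁ V₂ : Polynomial ℝ) (H : HermMat N) (p : Om N) :
    HasLineDerivAt ℝ (wt N T V₁ V₂)
      (-((N : ℂ) / (T : ℂ)) * ((Polynomial.aeval p.2.1 V₂.derivative - p.1.1) * H.1).trace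
        * wt N T V₁ V₂ p) p (0, H) := by
  simpa using wt_deriv T V₁ V₂ p (0, H)

lemma goodG1 (V : Polynomial ℝ) : MGood (fun p : Om N => Polynomial.aeval p.1.1 V - p.2.1) :=
  (MGood.fst.aeval V).sub MGood.snd

lemma goodG2 (V : Polynomial ℝ) : MGood (fun p : Om N => Polynomial.aeval p.2.1 V - p.1.1) :=
  (MGood.snd.aeval V).sub MGood.fst

lemma eq1 (hN : 1 ≤ N) {T : ℝ} (hT : 0 < T) {V₁ V₂ : Polynomial ℝ} (h : Conf V₁ V₂)
    {x y : ℂ} (hx : x.im ≠ 0) (hy : y.im ≠ 0) :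
    Ex μ T V₁ V₂ (fun p => (Res x p.1.1 * Res y p.2.1).trace * (Res y p.2.1).trace) =
      (N : ℂ) / (T : ℂ) * ((Polynomial.aeval y V₂.derivative - x) *
        Ex μ T V₁ V₂ (fun p => (Res x p.1.1 * Res y p.2.1).trace) -
        Ex μ T V₁ V₂ (fun p => (Res x p.1.1 * SVmat V₂ y p.2.1).trace) +
        Ex μ T V₁ V₂ (fun p => (Res y p.2.1).trace)) := by
  have hA : MGood (fun p : Om N => Res x p.1.1) := res_good1 hx
  have hB : MGood (fun p : Om N => Res y p.2.1) := res_good2 hy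
  have hS : MGood (fun p : Om N => SVmat V₂ y p.2.1) := MGood.snd.SV V₂ y
  rw [loop_Ex μ hN hT h (fun H => (0, H)) (F := fun p => Res x p.1.1 * Res y p.2.1)
    (P := fun p => Res x p.1.1 * Res y p.2.1) (Q := fun p => Res y p.2.1)
    (hA.mul hB) (goodG2 V₂.derivative) (hA.mul hB) hB ?_ (wd2 T V₁ V₂)]
  · refine congrArg _ ?_
    rw [← Ex_mul, ← Ex_sub μ hN hT h ((Good.const _).mul (hA.mul hB).trace) (hA.mul hS).trace,
      ← Ex_add μ hN hT h (((Good.const _).mul (hA.mul hB).trace).sub (hA.mul hS).trace) hB.trace]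
    congr 1
    ext p
    have e1 : (Polynomial.aeval p.2.1 V₂.derivative * (Res x p.1.1 * Res y p.2.1)).trace =
        (Res x p.1.1 * (Res y p.2.1 * Polynomial.aeval p.2.1 V₂.derivative)).trace := by
      rw [Matrix.trace_mul_comm, mul_assoc]
    rw [sub_mul, Matrix.trace_sub, e1, res_aeval V₂ hy, ← mul_assoc, mul_res hx, mul_sub, sub_mul,
      one_mul, Matrix.mul_smul, Matrix.smul_mul]
    simp only [Matrix.trace_sub, Matrix.trace_smul, smul_eq_mul]
    ring
  · intro H p i j
    have := ((MD.resolvent p.1 0 hx).mul (MD.resolvent p.2 H hy)) i j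
    refine HasDerivAt.congr_deriv this ?_
    simp [mul_assoc]

lemma eq2 (hN : 1 ≤ N) {T : ℝ} (hT : 0 < T) {V₁ V₂ : Polynomial ℝ} (h : Conf V₁ V₂)
    {x : ℂ} (y : ℂ) (hx : x.im ≠ 0) :
    Ex μ T V₁ V₂ (fun p => (Res x p.1.1 * SVmat V₂ y p.2.1).trace * (Res x p.1.1).trace) =
      (N : ℂ) / (T : ℂ) * ((Polynomial.aeval x V₁.derivative - y) *
        Ex μ T V₁ V₂ (fun p => (Res x p.1.1 * SVmat V₂ y p.2.1).trace) -
        Ex μ T V₁ V₂ (fun p => (SVmat V₁ x p.1.1 * SVmat V₂ y p.2.1).trace) +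
        Polynomial.aeval y V₂.derivative * Ex μ T V₁ V₂ (fun p => (Res x p.1.1).trace) -
        Ex μ T V₁ V₂ (fun p => (Polynomial.aeval p.2.1 V₂.derivative * Res x p.1.1).trace)) := by
  have hA : MGood (fun p : Om N => Res x p.1.1) := res_good1 hx
  have hS : MGood (fun p : Om N => SVmat V₂ y p.2.1) := MGood.snd.SV V₂ y
  have hS1 : MGood (fun p : Om N => SVmat V₁ x p.1.1) := MGood.fst.SV V₁ x
  have hV : MGood (fun p : Om N => Polynomial.aeval p.2.1 V₂.derivative) := MGood.snd.aeval _
  simp only [mul_comm (Matrix.trace (Res x _ * SVmat V₂ y _))]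
  rw [loop_Ex μ hN hT h (fun H => (H, 0)) (F := fun p => Res x p.1.1 * SVmat V₂ y p.2.1)
    (P := fun p => Res x p.1.1) (Q := fun p => Res x p.1.1 * SVmat V₂ y p.2.1)
    (hA.mul hS) (goodG1 V₁.derivative) hA (hA.mul hS) ?_ (wd1 T V₁ V₂)]
  · refine congrArg _ ?_
    rw [← Ex_mul, ← Ex_mul,
      ← Ex_sub μ hN hT h ((Good.const _).mul (hA.mul hS).trace) (hS1.mul hS).trace,
      ← Ex_add μ hN hT h (((Good.const _).mul (hA.mul hS).trace).sub (hS1.mul hS).trace)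
        ((Good.const _).mul hA.trace),
      ← Ex_sub μ hN hT h ((((Good.const _).mul (hA.mul hS).trace).sub (hS1.mul hS).trace).add
        ((Good.const _).mul hA.trace)) (hV.mul hA).trace]
    congr 1
    ext p
    have e1 : (p.2.1 * (Res x p.1.1 * SVmat V₂ y p.2.1)).trace =
        (Res x p.1.1 * (SVmat V₂ y p.2.1 * p.2.1)).trace := by
      rw [Matrix.trace_mul_comm, mul_assoc]
    rw [sub_mul, Matrix.trace_sub, e1, SV_snd, ← mul_assoc, aeval_res V₁ hx, mul_add, mul_sub,
      sub_mul, Matrix.mul_smul, Matrix.mul_smul, Matrix.smul_mul, mul_one,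
      Matrix.trace_mul_comm (Polynomial.aeval p.2.1 V₂.derivative)]
    simp only [Matrix.trace_sub, Matrix.trace_add, Matrix.trace_smul, smul_eq_mul]
    ring
  · intro H p i j
    have := ((MD.resolvent p.1 H hx).mul (MD.const (SVmat V₂ y p.2.1))) i j
    have e : (fun t : ℝ => (fun p : Om N => (Res x p.1.1 * SVmat V₂ y p.2.1) i j) (p + t • (H, 0)))
        = fun t : ℝ => (Res x (p.1 + t • H).1 * SVmat V₂ y p.2.1) i j := by
      ext t
      have : (p + t • ((H, 0) : Om N)).2 = p.2 := by simp
      change (Res x (p.1 + t • H).1 * SVmat V₂ y (p + t • ((H, 0) : Om N)).2.1) i j = _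
      rw [this]
    unfold HasLineDerivAt
    rw [e]
    refine HasDerivAt.congr_deriv this ?_
    simp [mul_assoc]

lemma eq3 (hN : 1 ≤ N) {T : ℝ} (hT : 0 < T) {V₁ V₂ : Polynomial ℝ} (h : Conf V₁ V₂)
    {x : ℂ} (hx : x.im ≠ 0) :
    Ex μ T V₁ V₂ (fun p => (Polynomial.aeval p.2.1 V₂.derivative * Res x p.1.1).trace) =
      x * Ex μ T V₁ V₂ (fun p => (Res x p.1.1).trace) - N := by
  have hA : MGood (fun p : Om N => Res x p.1.1) := res_good1 hx
  have hV : MGood (fun p : Om N => Polynomial.aeval p.2.1 V₂.derivative) := MGood.snd.aeval _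
  have key := loop_Ex μ hN hT h (fun H => (0, H)) (F := fun p => Res x p.1.1)
    (P := fun _ => 0) (Q := fun _ => 0)
    hA (goodG2 V₂.derivative) (MGood.const 0) (MGood.const 0) (by
      intro H p i j
      refine HasDerivAt.congr_deriv (MD.resolvent p.1 0 hx i j) ?_
      simp) (wd2 T V₁ V₂)
  have hN' : (N : ℂ) ≠ 0 := by exact_mod_cast (by omega : N ≠ 0)
  have hT' : (T : ℂ) ≠ 0 := by exact_mod_cast hT.ne'
  simp only [Matrix.trace_zero, mul_zero] at key
  rw [Ex_const μ hN hT h] at key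
  have key2 := (mul_eq_zero.mp key.symm).resolve_left (div_ne_zero hN' hT')
  have e : (fun p : Om N => ((Polynomial.aeval p.2.1 V₂.derivative - p.1.1) * Res x p.1.1).trace) =
      fun p => (Polynomial.aeval p.2.1 V₂.derivative * Res x p.1.1).trace -
        (x * (Res x p.1.1).trace - N) := by
    ext p
    rw [sub_mul, mul_res hx]
    simp [Matrix.trace_sub, Matrix.trace_smul]
  rw [e, Ex_sub μ hN hT h (hV.mul hA).trace (((Good.const _).mul hA.trace).sub (Good.const _)),
    Ex_sub μ hN hT h ((Good.const _).mul hA.trace) (Good.const _), Ex_mul, Ex_const μ hN hT h] at key2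
  exact sub_eq_zero.mp key2

end

theorem loop_equation_mixed_correlation
    (N : ℕ) (hN : 1 ≤ N) (T : ℝ) (hT : 0 < T) (V₁ V₂ : Polynomial ℝ)
    (hconf : ∃ c > (0 : ℝ), ∃ C : ℝ, ∀ x y : ℝ,
      c * (x ^ 2 + y ^ 2) - C ≤ V₁.eval x + V₂.eval y - x * y)
    [MeasurableSpace (HermMat N)] [BorelSpace (HermMat N)]
    (μ : Measure (HermMat N)) [μ.IsAddHaarMeasure] :
    ∀ x y : ℂ, x.im ≠ 0 → y.im ≠ 0 →
      x ≠ Xfun N T V₁ V₂ μ y → y ≠ Yfun N T V₁ V₂ μ x →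
      (T : ℂ) * W12 N T V₁ V₂ μ x y
        = 1 - Efun N T V₁ V₂ μ x y /
              ((x - Xfun N T V₁ V₂ μ y) * (y - Yfun N T V₁ V₂ μ x)) +
            ((T : ℂ) ^ 2 / (N : ℂ) ^ 2) *
              (Uconn N T V₁ V₂ μ x y x /
                  ((x - Xfun N T V₁ V₂ μ y) * (y - Yfun N T V₁ V₂ μ x)) -
                W122 N T V₁ V₂ μ x y y / (x - Xfun N T V₁ V₂ μ y)) := by
  intro x y hx hy hX hY
  have k1 := eq1 μ hN hT hconf hx hy
  have k2 := eq2 μ hN hT hconf y hx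
  rw [eq3 μ hN hT hconf hx] at k2
  have hN' : (N : ℂ) ≠ 0 := by exact_mod_cast (by omega : N ≠ 0)
  have hT' : (T : ℂ) ≠ 0 := by exact_mod_cast hT.ne'
  have d1 : W122 N T V₁ V₂ μ x y y =
    Ex μ T V₁ V₂ (fun p => (Res x p.1.1 * Res y p.2.1).trace * (Res y p.2.1).trace)
      - (N : ℂ) ^ 2 * W12 N T V₁ V₂ μ x y * resolvent2 N T V₁ V₂ μ y := rfl
  have d2 : Uconn N T V₁ V₂ μ x y x =
    Ex μ T V₁ V₂ (fun p => (Res x p.1.1 * SVmat V₂ y p.2.1).trace * (Res x p.1.1).trace)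
      - (N : ℂ) ^ 2 * Ufun N T V₁ V₂ μ x y * resolvent1 N T V₁ V₂ μ x := rfl
  have d3 : W12 N T V₁ V₂ μ x y = 1 / (N : ℂ) *
    Ex μ T V₁ V₂ (fun p => (Res x p.1.1 * Res y p.2.1).trace) := rfl
  have d4 : resolvent2 N T V₁ V₂ μ y = 1 / (N : ℂ) *
    Ex μ T V₁ V₂ (fun p => (Res y p.2.1).trace) := rfl
  have d5 : resolvent1 N T V₁ V₂ μ x = 1 / (N : ℂ) *
    Ex μ T V₁ V₂ (fun p => (Res x p.1.1).trace) := rfl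
  have d6 : Ufun N T V₁ V₂ μ x y = 1 / (N : ℂ) *
    Ex μ T V₁ V₂ (fun p => (Res x p.1.1 * SVmat V₂ y p.2.1).trace) := rfl
  have d7 : Pfun N T V₁ V₂ μ x y = 1 / (N : ℂ) *
    Ex μ T V₁ V₂ (fun p => (SVmat V₁ x p.1.1 * SVmat V₂ y p.2.1).trace) := rfl
  have d8 : Xfun N T V₁ V₂ μ y = Polynomial.aeval y V₂.derivative
    - (T : ℂ) * resolvent2 N T V₁ V₂ μ y := rfl
  have d9 : Yfun N T V₁ V₂ μ x = Polynomial.aeval x V₁.derivative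
    - (T : ℂ) * resolvent1 N T V₁ V₂ μ x := rfl
  have d10 : Efun N T V₁ V₂ μ x y =
    (Polynomial.aeval x V₁.derivative - y) * (Polynomial.aeval y V₂.derivative - x)
    - (T : ℂ) * Pfun N T V₁ V₂ μ x y + (T : ℂ) := rfl
  replace hX := sub_ne_zero.mpr hX
  replace hY := sub_ne_zero.mpr hY
  rw [k1] at d1
  rw [k2] at d2
  generalize Ex μ T V₁ V₂ (fun p => (Res x p.1.1 * Res y p.2.1).trace) = a at *
  generalize Ex μ T V₁ V₂ (fun p => (Res y p.2.1).trace) = b at *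
  generalize Ex μ T V₁ V₂ (fun p => (Res x p.1.1).trace) = c at *
  generalize Ex μ T V₁ V₂ (fun p => (Res x p.1.1 * SVmat V₂ y p.2.1).trace) = d at *
  generalize Ex μ T V₁ V₂ (fun p => (SVmat V₁ x p.1.1 * SVmat V₂ y p.2.1).trace) = e at *
  generalize W122 N T V₁ V₂ μ x y y = w at *
  generalize Uconn N T V₁ V₂ μ x y x = uc at *
  generalize W12 N T V₁ V₂ μ x y = w12 at *
  generalize Ufun N T V₁ V₂ μ x y = u at *
  generalize Pfun N T V₁ V₂ μ x y = pp at *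
  generalize resolvent1 N T V₁ V₂ μ x = r1 at *
  generalize resolvent2 N T V₁ V₂ μ y = r2 at *
  generalize Efun N T V₁ V₂ μ x y = E at *
  generalize Xfun N T V₁ V₂ μ y = X at *
  generalize Yfun N T V₁ V₂ μ x = Y at *
  have q1 : Polynomial.aeval y V₂.derivative = X + T * r2 := by rw [d8]; ring
  have q2 : Polynomial.aeval x V₁.derivative = Y + T * r1 := by rw [d9]; ring
  have ha : a = N * w12 := by rw [d3]; field_simp
  have hb : b = N * r2 := by rw [d4]; field_simp
  have hc : c = N * r1 := by rw [d5]; field_simp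
  have hd : d = N * u := by rw [d6]; field_simp
  have he : e = N * pp := by rw [d7]; field_simp
  clear d3 d4 d5 d6 d7 d8 d9 k1 k2
  rw [q1, q2] at d10
  rw [q1] at d1
  rw [q1, q2] at d2
  subst ha hb hc hd he d10 d1 d2
  field_simp
  ring
end
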